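/- Let A_S be an Artin-Tits group of large type, let S₀ ⊆ S and g ∈ A_S. (1) Let g₀ be an element of minimal length in the coset gA_{S₀} and let h ∈ A_{S₀} satisfy g = g₀h; then for any geodesic word w₀ representing g₀ and any geodesic word z representing h, the concatenation w₀z is a geodesic word representing g. (2) The left coset gA_{S₀} contains a unique element of minimal length. -/

import Mathlib

namespace ArtinTits

open Classical List

variable {S : Type*}

/-- A word over `S ∪ S⁻¹`: a list of letters, each a generator together with a sign
(`true` = the generator itself, `false` = its formal inverse). -/
abbrev Word (S : Type*) := List (S × Bool)

/-- The formal inverse of a word. -/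
def wordInv (w : Word S) : Word S := w.reverse.map fun l => (l.1, !l.2)

/-- `[x,y,j⟩`: the alternating positive word `xyxy⋯` with `j` letters, beginning with `x`. -/
def altWord (x y : S) : ℕ → Word S
  | 0 => []
  | j + 1 => (x, true) :: altWord y x j

/-- `⟨x,y,j]`: the alternating positive word `⋯xy` with `j` letters, ending with `y`. -/
def altWordR (x y : S) (j : ℕ) : Word S := (altWord y x j).reverse

/-- The data of a labelled finite complete simplicial graph `Γ₀`: a symmetric label map
with values in `{2,3,…} ∪ {∞}` on pairs of distinct vertices. -/
structure ArtinData (S : Type*) where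
  m : S → S → ℕ∞
  symm : ∀ s t, m s t = m t s
  two_le : ∀ s t : S, s ≠ t → 2 ≤ m s t

/-- `u = v` is a defining (braid) relation of the Artin–Tits presentation. -/
def IsRel (A : ArtinData S) (u v : Word S) : Prop :=
  ∃ (s t : S) (k : ℕ), s ≠ t ∧ A.m s t = (k : ℕ∞) ∧
    u = altWord s t k ∧ v = altWord t s k

/-- The relator set of the Artin–Tits presentation, inside the free group. -/
def rels (A : ArtinData S) : Set (FreeGroup S) :=
  {x | ∃ u v : Word S, IsRel A u v ∧ x = FreeGroup.mk u * (FreeGroup.mk v)⁻¹}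

/-- The Artin–Tits group `A(Γ₀)` of the presentation. -/
abbrev ArtinGroup (A : ArtinData S) := PresentedGroup (rels A)

/-- `w̄`: the element of the Artin–Tits group represented by the word `w`. -/
def wbar (A : ArtinData S) (w : Word S) : ArtinGroup A :=
  PresentedGroup.mk (rels A) (FreeGroup.mk w)

/-! ### Special transformations -/

/-- Type 0: delete a factor `s s⁻¹` or `s⁻¹ s`. -/
def Step0 (w w' : Word S) : Prop :=
  ∃ (w₁ w₂ : Word S) (s : S) (b : Bool),
    w = w₁ ++ [(s, b), (s, !b)] ++ w₂ ∧ w' = w₁ ++ w₂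

/-- Type ∞: insert a factor `s s⁻¹` or `s⁻¹ s` (the inverse of type 0). -/
def StepInfty (w w' : Word S) : Prop := Step0 w' w

/-- Type 1: replace a factor `v` by `u`, or `v⁻¹` by `u⁻¹`, where `u = v` is a defining
relation. -/
def Step1 (A : ArtinData S) (w w' : Word S) : Prop :=
  ∃ (w₁ w₂ u v : Word S), IsRel A u v ∧
    ((w = w₁ ++ v ++ w₂ ∧ w' = w₁ ++ u ++ w₂) ∨
     (w = w₁ ++ wordInv v ++ w₂ ∧ w' = w₁ ++ wordInv u ++ w₂))

/-- Type 2r: for a defining relation `u₁u₂ = v₁v₂` with `u₁, v₁` non-empty, replace a factor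
`v₁⁻¹ u₁` by `v₂ u₂⁻¹`. -/
def Step2r (A : ArtinData S) (w w' : Word S) : Prop :=
  ∃ (w₁ w₂ u₁ u₂ v₁ v₂ : Word S), IsRel A (u₁ ++ u₂) (v₁ ++ v₂) ∧
    u₁ ≠ [] ∧ v₁ ≠ [] ∧
    w = w₁ ++ wordInv v₁ ++ u₁ ++ w₂ ∧ w' = w₁ ++ v₂ ++ wordInv u₂ ++ w₂

/-- Type 2l: for a defining relation `u₁u₂ = v₁v₂` with `u₂, v₂` non-empty, replace a factor
`v₂ u₂⁻¹` by `v₁⁻¹ u₁`. -/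
def Step2l (A : ArtinData S) (w w' : Word S) : Prop :=
  ∃ (w₁ w₂ u₁ u₂ v₁ v₂ : Word S), IsRel A (u₁ ++ u₂) (v₁ ++ v₂) ∧
    u₂ ≠ [] ∧ v₂ ≠ [] ∧
    w = w₁ ++ v₂ ++ wordInv u₂ ++ w₂ ∧ w' = w₁ ++ wordInv v₁ ++ u₁ ++ w₂

/-- Type 2: a type 2r or type 2l transformation. -/
def Step2 (A : ArtinData S) (w w' : Word S) : Prop := Step2r A w w' ∨ Step2l A w w'

/-- `p` is the greatest (longest) common left factor of `x` and `y`. -/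
def IsLCPrefix (p x y : Word S) : Prop :=
  p <+: x ∧ p <+: y ∧ ∀ q : Word S, q <+: x → q <+: y → q.length ≤ p.length

/-- `p` is the greatest (longest) common right factor of `x` and `y`. -/
def IsLCSuffix (p x y : Word S) : Prop :=
  p <:+ x ∧ p <:+ y ∧ ∀ q : Word S, q <:+ x → q <:+ y → q.length ≤ p.length

/-- Type 2r⋆ : a type 2r transformation `w₁ v⁻¹ v' w₂ → w₁ u (u')⁻¹ w₂` (with `vu = v'u'` a
defining relation) such that `v` is the greatest common left factor of `vu` and `v w₁⁻¹`, and
`v'` is the greatest common left factor of `v'u'` and `v' w₂`. -/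
def Step2rStar (A : ArtinData S) (w w' : Word S) : Prop :=
  ∃ (w₁ w₂ v u v' u' : Word S), IsRel A (v ++ u) (v' ++ u') ∧
    v ≠ [] ∧ v' ≠ [] ∧
    w = w₁ ++ wordInv v ++ v' ++ w₂ ∧
    w' = w₁ ++ u ++ wordInv u' ++ w₂ ∧
    IsLCPrefix v (v ++ u) (v ++ wordInv w₁) ∧
    IsLCPrefix v' (v' ++ u') (v' ++ w₂)

/-- Type 2l⋆ : a type 2l transformation `w₁ v (v')⁻¹ w₂ → w₁ u⁻¹ u' w₂` (with `uv = u'v'` a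
defining relation) such that `v` is the greatest common right factor of `uv` and `w₁ v`, and
`v'` is the greatest common right factor of `u'v'` and `w₂⁻¹ v'`. -/
def Step2lStar (A : ArtinData S) (w w' : Word S) : Prop :=
  ∃ (w₁ w₂ v u v' u' : Word S), IsRel A (u ++ v) (u' ++ v') ∧
    v ≠ [] ∧ v' ≠ [] ∧
    w = w₁ ++ v ++ wordInv v' ++ w₂ ∧
    w' = w₁ ++ wordInv u ++ u' ++ w₂ ∧
    IsLCSuffix v (u ++ v) (w₁ ++ v) ∧
    IsLCSuffix v' (u' ++ v') (wordInv w₂ ++ v')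

/-- Type 2⋆ : a type 2r⋆ or type 2l⋆ transformation. -/
def Step2Star (A : ArtinData S) (w w' : Word S) : Prop :=
  Step2rStar A w w' ∨ Step2lStar A w w'

/-- `w →_{0,1,2} w'`. -/
def Steps012 (A : ArtinData S) : Word S → Word S → Prop :=
  Relation.ReflTransGen fun x y => Step0 x y ∨ Step1 A x y ∨ Step2 A x y

/-- `w →_{0,1,2⋆} w'`. -/
def Steps012Star (A : ArtinData S) : Word S → Word S → Prop :=
  Relation.ReflTransGen fun x y => Step0 x y ∨ Step1 A x y ∨ Step2Star A x y

/-- `w →_{2⋆} w'`. -/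
def Steps2Star (A : ArtinData S) : Word S → Word S → Prop :=
  Relation.ReflTransGen (Step2Star A)

/-- `w →_{1,2⋆} w'`. -/
def Steps12Star (A : ArtinData S) : Word S → Word S → Prop :=
  Relation.ReflTransGen fun x y => Step1 A x y ∨ Step2Star A x y

/-- `w →_{1,2} w'`. -/
def Steps12 (A : ArtinData S) : Word S → Word S → Prop :=
  Relation.ReflTransGen fun x y => Step1 A x y ∨ Step2 A x y

/-! ### Classes of words -/

/-- A positive word: written over `S`. -/
def Positive (w : Word S) : Prop := ∀ l ∈ w, l.2 = true

/-- A negative word: written over `S⁻¹`. -/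
def Negative (w : Word S) : Prop := ∀ l ∈ w, l.2 = false

/-- A signed word: positive or negative. -/
def Signed (w : Word S) : Prop := Positive w ∨ Negative w

/-- An unsigned word: neither positive nor negative. -/
def Unsigned (w : Word S) : Prop := ¬ Positive w ∧ ¬ Negative w

/-- A freely reduced word: no factor `s s⁻¹` or `s⁻¹ s`. -/
def FreelyReduced (w : Word S) : Prop :=
  ∀ (w₁ w₂ : Word S) (s : S) (b : Bool), w ≠ w₁ ++ [(s, b), (s, !b)] ++ w₂

/-- A square-free word: no factor `aa`. -/
def SquareFree (w : Word S) : Prop := ∀ a : S × Bool, ¬ [a, a] <:+: w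

/-- `p̃(w)`: the length of the longest square-free positive factor of `w`. -/
noncomputable def ptilde (w : Word S) : ℕ :=
  sSup {n | ∃ v : Word S, v <:+: w ∧ Positive v ∧ SquareFree v ∧ v.length = n}

/-- `ñ(w)`: the length of the longest negative factor of `w` whose formal inverse is
square-free. -/
noncomputable def ntilde (w : Word S) : ℕ :=
  sSup {n | ∃ v : Word S, v <:+: w ∧ Negative v ∧ SquareFree (wordInv v) ∧ v.length = n}

/-- `p(w) = min(p̃(w), m)`. -/
noncomputable def pfun (M : ℕ) (w : Word S) : ℕ := min (ptilde w) M

/-- `n(w) = min(ñ(w), m)`. -/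
noncomputable def nfun (M : ℕ) (w : Word S) : ℕ := min (ntilde w) M

/-- `Ω(Γ₀)` (for a dihedral presentation with label `M`): the freely reduced words with
`max(p(w), n(w)) < M`. -/
def Omega (M : ℕ) (w : Word S) : Prop :=
  FreelyReduced w ∧ max (pfun M w) (nfun M w) < M

/-- A signed square-free word (square-free positive, or negative with square-free inverse). -/
def SignedSF (w : Word S) : Prop :=
  (Positive w ∧ SquareFree w) ∨ (Negative w ∧ SquareFree (wordInv w))

/-- `v` is the maximal square-free signed left factor of `w`. -/
def MaxSignedSFPrefix (v w : Word S) : Prop :=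
  v <+: w ∧ SignedSF v ∧ ∀ v' : Word S, v' <+: w → SignedSF v' → v'.length ≤ v.length

/-- `(v₁, …, v_k)` is the `⋆`-decomposition of `w`: the `v_i` are non-empty, `w = v₁⋯v_k`,
and each `v_i` is the maximal square-free signed left factor of `v_i⋯v_k`. -/
def StarDecomp (w : Word S) (L : List (Word S)) : Prop :=
  w = L.flatten ∧ (∀ v ∈ L, v ≠ ([] : Word S)) ∧
    ∀ i (h : i < L.length), MaxSignedSFPrefix (L.get ⟨i, h⟩) ((L.drop i).flatten)

/-! ### Groups, parabolic subgroups, geodesics -/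

/-- A word written over `T ∪ T⁻¹` for a subset `T` of the generators. -/
def WordOver (T : Set S) (w : Word S) : Prop := ∀ l ∈ w, l.1 ∈ T

/-- The standard parabolic subgroup `A_T` generated by the image of `T ⊆ S`. -/
def parab (A : ArtinData S) (T : Set S) : Subgroup (ArtinGroup A) :=
  Subgroup.closure {x | ∃ s ∈ T, x = wbar A [(s, true)]}

/-- A geodesic word: of minimal length among all words representing the same element. -/
def Geodesic (A : ArtinData S) (w : Word S) : Prop :=
  ∀ w' : Word S, wbar A w' = wbar A w → w.length ≤ w'.length

/-- A word over `T ∪ T⁻¹` that is geodesic among the words over `T ∪ T⁻¹` representing the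
same element. -/
def GeodesicOver (A : ArtinData S) (T : Set S) (w : Word S) : Prop :=
  WordOver T w ∧
    ∀ w' : Word S, WordOver T w' → wbar A w' = wbar A w → w.length ≤ w'.length

/-- The length of a group element: the length of any geodesic representative word. -/
noncomputable def elLength (A : ArtinData S) (g : ArtinGroup A) : ℕ :=
  sInf {n | ∃ w : Word S, wbar A w = g ∧ w.length = n}

/-- A positive element: one represented by a positive word. -/
def IsPosElt (A : ArtinData S) (g : ArtinGroup A) : Prop :=
  ∃ w : Word S, Positive w ∧ wbar A w = g

/-- An `H`-transversal: a subset containing `1` and exactly one element of each left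
`H`-coset. -/
def IsLeftTransversal {G : Type*} [Group G] (H : Subgroup G) (T : Set G) : Prop :=
  (1 : G) ∈ T ∧ ∀ g : G, ∃! x, x ∈ T ∧ g⁻¹ * x ∈ H

/-! ### Properties H, H⁺, H# -/

/-- Property `H`: `w →_{0,1,2} ε ↔ w̄ = 1`. -/
def PropertyH (A : ArtinData S) : Prop :=
  ∀ w : Word S, Steps012 A w [] ↔ wbar A w = 1

/-- Property `H⁺`: every word representing an element of a standard parabolic subgroup
`A_{S₀}` can be transformed by `→_{0,1,2⋆}` into a word over `S₀ ∪ S₀⁻¹`. -/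
def PropertyHPlus (A : ArtinData S) : Prop :=
  ∀ (S₀ : Set S) (w : Word S), wbar A w ∈ parab A S₀ →
    ∃ w₀ : Word S, WordOver S₀ w₀ ∧ Steps012Star A w w₀

/-- Property `H#` with respect to an `S`-sequence of transversals `T`. -/
def PropertyHSharpWrt (A : ArtinData S) (T : Set S → Set (ArtinGroup A)) : Prop :=
  (∀ S₀ : Set S, IsLeftTransversal (parab A S₀) (T S₀)) ∧
    ∀ (S' S₀ : Set S) (w : Word S), wbar A w ∈ parab A S' →
      ∃ v u : Word S, WordOver S' v ∧ WordOver (S' ∩ S₀) u ∧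
        Steps012 A w (v ++ u) ∧ wbar A v ∈ T S₀

/-- Property `H#`: property `H#` with respect to some `S`-sequence of transversals. -/
def PropertyHSharp (A : ArtinData S) : Prop :=
  ∃ T : Set S → Set (ArtinGroup A), PropertyHSharpWrt A T

/-! ### Critical words and the involution τ (relative to a dihedral pair) -/

/-- The permutation `δ` induced by conjugation by `Δ`, extended letterwise to words:
the identity if `M` is even, and the swap of `s` and `t` if `M` is odd. -/
noncomputable def deltaMap (s t : S) (M : ℕ) (w : Word S) : Word S :=
  if Even M then w
  else w.map fun l => (if l.1 = s then t else if l.1 = t then s else l.1, l.2)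

/-- `w` is an unsigned critical word (of the dihedral pair `{s,t}` with label `M`) and
`w' = τ(w)`. -/
def UCritTauPair (A : ArtinData S) (s t : S) (M : ℕ) (w w' : Word S) : Prop :=
  WordOver {s, t} w ∧ FreelyReduced w ∧ Unsigned w ∧ GeodesicOver A {s, t} w ∧
  pfun M w + nfun M w = M ∧
  ∃ (x y z z' : S) (wm : Word S),
    ({x, y} : Set S) = {s, t} ∧ ({z, z'} : Set S) = {s, t} ∧
    ((w = altWord x y (pfun M w) ++ wm ++ wordInv (altWord z z' (nfun M w)) ∧
      w' = wordInv (altWordR x y (nfun M w)) ++ deltaMap s t M wm ++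
        altWordR z z' (pfun M w)) ∨
     (w = wordInv (altWordR x y (nfun M w)) ++ wm ++ altWordR z z' (pfun M w) ∧
      w' = altWord x y (pfun M w) ++ deltaMap s t M wm ++
        wordInv (altWord z z' (nfun M w))))

/-- `w` is a positive critical word (of the dihedral pair `{s,t}` with label `M`) and
`w' = τ(w)`. -/
def PosCritTauPair (A : ArtinData S) (s t : S) (M : ℕ) (w w' : Word S) : Prop :=
  WordOver {s, t} w ∧ Positive w ∧ pfun M w = M ∧
  ∃ (x y : S) (wm : Word S), ({x, y} : Set S) = {s, t} ∧ pfun M wm < M ∧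
    ((w = altWord x y M ++ wm ∧
      (w' = deltaMap s t M wm ++ altWordR x y M ∨
       w' = deltaMap s t M wm ++ altWordR y x M) ∧
      w'.getLast? ≠ w.getLast?) ∨
     (w = wm ++ altWordR x y M ∧
      (w' = altWord x y M ++ deltaMap s t M wm ∨
       w' = altWord y x M ++ deltaMap s t M wm) ∧
      w'.head? ≠ w.head?))

/-- `w` is a negative critical word and `w' = τ(w)` (defined via formal inverses). -/
def NegCritTauPair (A : ArtinData S) (s t : S) (M : ℕ) (w w' : Word S) : Prop :=
  PosCritTauPair A s t M (wordInv w) (wordInv w')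

/-- `w` is a critical word (unsigned, positive or negative) and `w' = τ(w)`. -/
def CritTauPair (A : ArtinData S) (s t : S) (M : ℕ) (w w' : Word S) : Prop :=
  UCritTauPair A s t M w w' ∨ PosCritTauPair A s t M w w' ∨ NegCritTauPair A s t M w w'

/-- A type β transformation relative to the dihedral pair `{s,t}` with label `M`:
replace a critical factor `v` by `τ(v)`. -/
def StepBetaPair (A : ArtinData S) (s t : S) (M : ℕ) (w w' : Word S) : Prop :=
  ∃ (w₁ w₂ v v' : Word S), w = w₁ ++ v ++ w₂ ∧ w' = w₁ ++ v' ++ w₂ ∧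
    CritTauPair A s t M v v'

/-- A type β transformation (in an Artin–Tits group): a type β transformation relative to some
dihedral standard parabolic subgroup (a pair of generators with finite label). -/
def StepBeta (A : ArtinData S) (w w' : Word S) : Prop :=
  ∃ (s t : S) (M : ℕ), s ≠ t ∧ A.m s t = (M : ℕ∞) ∧ StepBetaPair A s t M w w'

/-! ### Restriction, direct products, Coxeter graph notions -/

/-- The Artin–Tits presentation induced on a subset `T` of the generators (the presentation of
the standard parabolic subgroup `A_T`). -/
def ArtinData.restrict (A : ArtinData S) (T : Set S) : ArtinData T where
  m a b := A.m a b
  symm a b := A.symm a b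
  two_le a b h := A.two_le a b fun h' => h (Subtype.ext h')

/-- The Artin–Tits presentation on the disjoint union `S₁ ⊕ S₂` obtained from presentations on
`S₁` and `S₂` by adding the commuting relations `s₁s₂ = s₂s₁` (label `2`) for `s₁ ∈ S₁`,
`s₂ ∈ S₂`. -/
def prodData {S₁ S₂ : Type*} (A₁ : ArtinData S₁) (A₂ : ArtinData S₂) :
    ArtinData (S₁ ⊕ S₂) where
  m x y :=
    match x, y with
    | Sum.inl a, Sum.inl b => A₁.m a b
    | Sum.inr a, Sum.inr b => A₂.m a b
    | _, _ => 2
  symm x y := by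
    cases x <;> cases y
    · exact A₁.symm _ _
    · rfl
    · rfl
    · exact A₂.symm _ _
  two_le x y h := by
    cases x <;> cases y
    · exact A₁.two_le _ _ fun h' => h (congrArg Sum.inl h')
    · exact le_rfl
    · exact le_rfl
    · exact A₂.two_le _ _ fun h' => h (congrArg Sum.inr h')

/-- Adjacency in the Coxeter graph `Γ` restricted to `T`: distinct vertices of `T` joined by an
edge (i.e. with label `≠ 2`, edges labelled `2` being removed in `Γ`). -/
def coxAdj (A : ArtinData S) (T : Set S) (x y : S) : Prop :=
  x ∈ T ∧ y ∈ T ∧ x ≠ y ∧ A.m x y ≠ 2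

/-- The full subgraph of the Coxeter graph on the vertex subset `T` is connected. -/
def CoxConnected (A : ArtinData S) (T : Set S) : Prop :=
  ∀ x ∈ T, ∀ y ∈ T, Relation.ReflTransGen (coxAdj A T) x y

/-- The relator set of the Coxeter presentation on `T`: the Artin relations together with the
squares of the generators. -/
def coxRels (A : ArtinData S) (T : Set S) : Set (FreeGroup T) :=
  rels (A.restrict T) ∪ {g | ∃ x : T, g = FreeGroup.of x * FreeGroup.of x}

/-- The induced presentation on `T` is of spherical type: its Coxeter group is finite. -/
def SphericalType (A : ArtinData S) (T : Set S) : Prop :=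
  Finite (PresentedGroup (coxRels A T))

/-- The induced presentation on `T` is of large type: all labels are `≥ 3` (possibly `∞`). -/
def LargeTypeOn (A : ArtinData S) (T : Set S) : Prop :=
  ∀ x ∈ T, ∀ y ∈ T, x ≠ y → 3 ≤ A.m x y

/-! ### Amalgams of rank-two systems

The data below abstract what is needed of the dihedral Artin–Tits groups: for each pair `P` of
generators with finite label a set `D P` on which the generators of `P` act, with a notion of
length and, for each generator `a ∈ P`, the exponent `ex a d` of the maximal power of `a` at the
end of `d`. -/

universe u

/-- A system of rank-two pieces, evaluated in a group `G` with distinguished elements `gen s`. -/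
structure RankTwoSystem (S G : Type u) [Group G] (gen : S → G) where
  Pr : Type u
  Mem : S → Pr → Prop
  eq_of_mem : ∀ {a b : S} {P Q : Pr}, a ≠ b → Mem a P → Mem b P → Mem a Q → Mem b Q → P = Q
  eq_or_eq : ∀ {a b c : S} {P : Pr}, a ≠ b → Mem a P → Mem b P → Mem c P → c = a ∨ c = b
  exists_mem : ∀ P : Pr, ∃ a, Mem a P
  exists_other : ∀ {a : S} {P : Pr}, Mem a P → ∃ b, b ≠ a ∧ Mem b P
  D : Pr → Type
  one : ∀ P : Pr, D P
  pw : ∀ {P : Pr}, D P → S → ℤ → D P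
  ex : ∀ {P : Pr}, S → D P → ℤ
  len : ∀ {P : Pr}, D P → ℕ
  ev : ∀ {P : Pr}, D P → G
  pw_zero : ∀ {P : Pr} (d : D P) (a : S), pw d a 0 = d
  pw_pw : ∀ {P : Pr} (d : D P) (a : S) (k l : ℤ), pw (pw d a k) a l = pw d a (k + l)
  ex_pw : ∀ {P : Pr} {a : S} (d : D P) (k : ℤ), Mem a P → ex a (pw d a k) = ex a d + k
  len_eq : ∀ {P : Pr} {a : S} (d : D P), Mem a P →
    len d = len (pw d a (-ex a d)) + (ex a d).natAbs
  len_one : ∀ P : Pr, len (one P) = 0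
  exists_ex_ne : ∀ {P : Pr} {d : D P}, d ≠ one P → ∃ a, Mem a P ∧ ex a d ≠ 0
  large : ∀ {P : Pr} {a b : S} (k l : ℤ), a ≠ b → Mem a P → Mem b P →
    ex a (pw (pw (one P) b k) a l) ≠ 0 → ex b (pw (pw (one P) b k) a l) = 0
  ev_one : ∀ P : Pr, ev (one P) = 1
  ev_pw : ∀ {P : Pr} {a : S} (d : D P) (k : ℤ), Mem a P → ev (pw d a k) = ev d * gen a ^ k

namespace RankTwoSystem

variable {S G : Type u} [Group G] {gen : S → G} (Λ : RankTwoSystem S G gen)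

/-- Every generator of `P` occurs at the end of `d`. -/
def Full {P : Λ.Pr} (d : Λ.D P) : Prop := ∀ a, Λ.Mem a P → Λ.ex a d ≠ 0

variable {Λ} {P Q : Λ.Pr} {a b : S}

lemma ex_one (ha : Λ.Mem a P) : Λ.ex a (Λ.one P) = 0 := by
  have := Λ.len_eq (Λ.one P) ha
  rw [Λ.len_one] at this
  omega

lemma ex_pw_one_self (ha : Λ.Mem a P) (k : ℤ) : Λ.ex a (Λ.pw (Λ.one P) a k) = k := by
  rw [Λ.ex_pw _ _ ha, ex_one ha, zero_add]

lemma ex_pw_one_of_ne (hab : a ≠ b) (ha : Λ.Mem a P) (hb : Λ.Mem b P) (k : ℤ) :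
    Λ.ex b (Λ.pw (Λ.one P) a k) = 0 := by
  by_cases hk : k = 0
  · rw [hk, Λ.pw_zero, ex_one hb]
  · have h := Λ.large 0 k hab ha hb
    rw [Λ.pw_zero, ex_pw_one_self ha] at h
    exact h hk

lemma not_full_pw_pw (hab : a ≠ b) (ha : Λ.Mem a P) (hb : Λ.Mem b P) (k l : ℤ) :
    ¬ Λ.Full (Λ.pw (Λ.pw (Λ.one P) b k) a l) := fun h =>
  h b hb (Λ.large k l hab ha hb (h a ha))

lemma not_full_pw_one (ha : Λ.Mem a P) (k : ℤ) : ¬ Λ.Full (Λ.pw (Λ.one P) a k) := by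
  obtain ⟨b, hba, hb⟩ := Λ.exists_other ha
  exact fun h => h b hb (ex_pw_one_of_ne hba.symm ha hb k)

lemma not_full_one : ¬ Λ.Full (Λ.one P) := by
  obtain ⟨a, ha⟩ := Λ.exists_mem P
  exact fun h => h a ha (ex_one ha)

lemma pw_ne_one {d : Λ.D P} (ha : Λ.Mem a P) (hd : Λ.ex a d = 0) {k : ℤ} (hk : k ≠ 0) :
    Λ.pw d a k ≠ Λ.one P := fun h => by
  have := Λ.ex_pw d k ha
  rw [h, ex_one ha] at this
  omega

lemma len_pw {d : Λ.D P} (ha : Λ.Mem a P) (hd : Λ.ex a d = 0) (k : ℤ) :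
    Λ.len (Λ.pw d a k) = Λ.len d + k.natAbs := by
  rw [Λ.len_eq (Λ.pw d a k) ha, Λ.ex_pw _ _ ha, hd, Λ.pw_pw]
  simp [Λ.pw_zero]

lemma pw_neg_ex (d : Λ.D P) (a : S) : Λ.pw (Λ.pw d a (-Λ.ex a d)) a (Λ.ex a d) = d := by
  rw [Λ.pw_pw, neg_add_cancel, Λ.pw_zero]

lemma ex_pw_neg_ex (d : Λ.D P) (ha : Λ.Mem a P) : Λ.ex a (Λ.pw d a (-Λ.ex a d)) = 0 := by
  rw [Λ.ex_pw _ _ ha, add_neg_cancel]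

lemma len_pw_neg_ex_lt {d : Λ.D P} (ha : Λ.Mem a P) (h : Λ.ex a d ≠ 0) :
    Λ.len (Λ.pw d a (-Λ.ex a d)) < Λ.len d := by
  have := Λ.len_eq d ha
  omega

lemma ex_eq_zero_of_not_full {d : Λ.D P} (hd : ¬ Λ.Full d) (ha : Λ.Mem a P) (hb : Λ.Mem b P)
    (hab : a ≠ b) (h : Λ.ex a d ≠ 0) : Λ.ex b d = 0 := by
  simp only [Full, not_forall, not_not] at hd
  obtain ⟨c, hc, h0⟩ := hd
  rcases Λ.eq_or_eq hab ha hb hc with rfl | rfl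
  · exact absurd h0 h
  · exact h0

lemma D_induction {motive : Λ.D P → Prop} (one : motive (Λ.one P))
    (pw : ∀ (d : Λ.D P) (a : S) (k : ℤ), Λ.Mem a P → Λ.ex a d = 0 → k ≠ 0 →
      motive d → motive (Λ.pw d a k)) (d : Λ.D P) : motive d := by
  induction hn : Λ.len d using Nat.strong_induction_on generalizing d with
  | _ n ih =>
    by_cases h1 : d = Λ.one P
    · exact h1 ▸ one
    · obtain ⟨a, ha, hex⟩ := Λ.exists_ex_ne h1
      have h := pw _ a _ ha (ex_pw_neg_ex d ha) hex
        (ih _ (hn ▸ len_pw_neg_ex_lt ha hex) _ rfl)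
      rwa [pw_neg_ex] at h

variable (Λ)

/-- Normal forms: sequences of syllables, a syllable being a power of a generator or an element
of some `D P`. -/
inductive NF : Type u
  | nil : NF
  | sing (g : NF) (a : S) (k : ℤ) : NF
  | full (g : NF) (P : Λ.Pr) (d : Λ.D P) : NF

namespace NF

variable {Λ}

/-- The length of a normal form. -/
def size : NF Λ → ℕ
  | nil => 0
  | sing g _ k => size g + k.natAbs
  | full g _ d => size g + Λ.len d

/-- The group element represented by a normal form. -/
def eval : NF Λ → G
  | nil => 1
  | sing g a k => eval g * gen a ^ k
  | full g _ d => eval g * Λ.ev d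

/-- The exponent of the maximal power of `a` at the end. -/
noncomputable def expo (a : S) : NF Λ → ℤ
  | nil => 0
  | sing _ b k => if a = b then k else 0
  | full _ Q d => if Λ.Mem a Q then Λ.ex a d else 0

/-- The maximal `P`-component at the end. -/
noncomputable def comp : NF Λ → ∀ P : Λ.Pr, Λ.D P
  | nil, P => Λ.one P
  | sing g a k, P => if Λ.Mem a P then Λ.pw (comp g P) a k else Λ.one P
  | full _ Q d, P =>
    if h : Q = P then h ▸ d
    else if h : ∃ a, Λ.Mem a Q ∧ Λ.Mem a P then Λ.pw (Λ.one P) h.choose (Λ.ex h.choose d)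
    else Λ.one P

/-- Append `b ^ k`, given the residues `r P` of `g`. -/
noncomputable def pushAux (g : NF Λ) (r : Λ.Pr → NF Λ) (b : S) (k : ℤ) : NF Λ :=
  if h : ∃ P, Λ.Mem b P ∧ Λ.Full (Λ.pw (comp g P) b k) then
    full (r h.choose) h.choose (Λ.pw (comp g h.choose) b k)
  else sing g b k

/-- Append `d`, given the residues `r P` of `g`. -/
noncomputable def starAux (g : NF Λ) (r : Λ.Pr → NF Λ) (P : Λ.Pr) (d : Λ.D P) : NF Λ :=
  if h : d = Λ.one P then g
  else if Λ.Full d then full g P d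
  else if Λ.pw d (Λ.exists_ex_ne h).choose (-Λ.ex (Λ.exists_ex_ne h).choose d) = Λ.one P then
    pushAux g r (Λ.exists_ex_ne h).choose (Λ.ex (Λ.exists_ex_ne h).choose d)
  else
    sing (starAux g r P
      (Λ.pw d (Λ.exists_ex_ne h).choose (-Λ.ex (Λ.exists_ex_ne h).choose d)))
      (Λ.exists_ex_ne h).choose (Λ.ex (Λ.exists_ex_ne h).choose d)
termination_by Λ.len d
decreasing_by
  exact len_pw_neg_ex_lt (Λ.exists_ex_ne h).choose_spec.1 (Λ.exists_ex_ne h).choose_spec.2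

/-- What remains after removing the maximal `P`-component. -/
noncomputable def res : NF Λ → Λ.Pr → NF Λ
  | nil, _ => nil
  | sing g a k, P => if Λ.Mem a P then res g P else sing g a k
  | full g Q d, P =>
    if Q = P then g
    else if h : ∃ a, Λ.Mem a Q ∧ Λ.Mem a P then
      starAux g (res g) Q (Λ.pw d h.choose (-Λ.ex h.choose d))
    else full g Q d

/-- Append `b ^ k`. -/
noncomputable def push (g : NF Λ) (b : S) (k : ℤ) : NF Λ := pushAux g (res g) b k

/-- Append `d`. -/
noncomputable def star (g : NF Λ) (P : Λ.Pr) (d : Λ.D P) : NF Λ := starAux g (res g) P d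

/-- The normal forms in actual use. -/
def Valid : NF Λ → Prop
  | nil => True
  | sing g a k => Valid g ∧ k ≠ 0 ∧ expo a g = 0 ∧
      ∀ P, Λ.Mem a P → ¬ Λ.Full (Λ.pw (comp g P) a k)
  | full g P d => Valid g ∧ Λ.Full d ∧ comp g P = Λ.one P

lemma comp_sing_of_mem {g : NF Λ} {k : ℤ} (h : Λ.Mem a P) :
    comp (sing g a k) P = Λ.pw (comp g P) a k := if_pos h

lemma comp_sing_of_not_mem {g : NF Λ} {k : ℤ} (h : ¬ Λ.Mem a P) :
    comp (sing g a k) P = Λ.one P := if_neg h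

lemma comp_full_self {g : NF Λ} {d : Λ.D P} : comp (full g P d) P = d := by simp [comp]

lemma choose_eq {P Q : Λ.Pr} (hQP : Q ≠ P) (haQ : Λ.Mem a Q) (haP : Λ.Mem a P)
    (h : ∃ a, Λ.Mem a Q ∧ Λ.Mem a P) : h.choose = a := by
  by_contra hne
  exact hQP (Λ.eq_of_mem hne h.choose_spec.1 haQ h.choose_spec.2 haP)

lemma comp_full_of_mem {g : NF Λ} {d : Λ.D Q} (hQP : Q ≠ P) (haQ : Λ.Mem a Q)
    (haP : Λ.Mem a P) : comp (full g Q d) P = Λ.pw (Λ.one P) a (Λ.ex a d) := by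
  have h : ∃ a, Λ.Mem a Q ∧ Λ.Mem a P := ⟨a, haQ, haP⟩
  simp only [comp, dif_neg hQP, dif_pos h, choose_eq hQP haQ haP h]

lemma comp_full_of_disjoint {g : NF Λ} {d : Λ.D Q} (hQP : Q ≠ P)
    (h : ¬ ∃ a, Λ.Mem a Q ∧ Λ.Mem a P) : comp (full g Q d) P = Λ.one P := by
  simp only [comp, dif_neg hQP, dif_neg h]

lemma res_sing_of_mem {g : NF Λ} {k : ℤ} (h : Λ.Mem a P) :
    res (sing g a k) P = res g P := if_pos h

lemma res_sing_of_not_mem {g : NF Λ} {k : ℤ} (h : ¬ Λ.Mem a P) :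
    res (sing g a k) P = sing g a k := if_neg h

lemma res_full_self {g : NF Λ} {d : Λ.D P} : res (full g P d) P = g := by simp [res]

lemma res_full_of_mem {g : NF Λ} {d : Λ.D Q} (hQP : Q ≠ P) (haQ : Λ.Mem a Q)
    (haP : Λ.Mem a P) : res (full g Q d) P = star g Q (Λ.pw d a (-Λ.ex a d)) := by
  have h : ∃ a, Λ.Mem a Q ∧ Λ.Mem a P := ⟨a, haQ, haP⟩
  simp only [res, if_neg hQP, dif_pos h, choose_eq hQP haQ haP h, star]

lemma res_full_of_disjoint {g : NF Λ} {d : Λ.D Q} (hQP : Q ≠ P)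
    (h : ¬ ∃ a, Λ.Mem a Q ∧ Λ.Mem a P) : res (full g Q d) P = full g Q d := by
  simp only [res, if_neg hQP, dif_neg h]

lemma star_one (g : NF Λ) (P : Λ.Pr) : star g P (Λ.one P) = g := by
  rw [star, starAux, dif_pos rfl]

lemma star_full (g : NF Λ) {d : Λ.D P} (hd : Λ.Full d) : star g P d = full g P d := by
  have h1 : d ≠ Λ.one P := fun h => not_full_one (h ▸ hd)
  rw [star, starAux, dif_neg h1, if_pos hd]

lemma star_pw (g : NF Λ) {d : Λ.D P} {k : ℤ} (ha : Λ.Mem a P) (hd : Λ.ex a d = 0) (hk : k ≠ 0)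
    (hf : ¬ Λ.Full (Λ.pw d a k)) :
    star g P (Λ.pw d a k) = if d = Λ.one P then push g a k else sing (star g P d) a k := by
  have h1 := pw_ne_one ha hd hk
  have hex : Λ.ex a (Λ.pw d a k) = k := by rw [Λ.ex_pw _ _ ha, hd, zero_add]
  have hc : (Λ.exists_ex_ne h1).choose = a := by
    by_contra hne
    exact (Λ.exists_ex_ne h1).choose_spec.2 (ex_eq_zero_of_not_full hf ha
      (Λ.exists_ex_ne h1).choose_spec.1 (Ne.symm hne) (by rwa [hex]))
  have hd' : Λ.pw (Λ.pw d a k) a (-k) = d := by rw [Λ.pw_pw, add_neg_cancel, Λ.pw_zero]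
  rw [star, starAux, dif_neg h1, if_neg hf]
  simp only [hc, hex, hd']
  rfl

lemma ex_comp {g : NF Λ} (hg : Valid g) (ha : Λ.Mem a P) : Λ.ex a (comp g P) = expo a g := by
  induction g generalizing a P with
  | nil => exact ex_one ha
  | sing g b k ih =>
    obtain ⟨hv, hk, he, hf⟩ := hg
    by_cases hb : Λ.Mem b P
    · rw [comp_sing_of_mem hb]
      by_cases hab : a = b
      · subst hab
        rw [Λ.ex_pw _ _ ha, ih hv ha, he]
        simp [expo]
      · have : Λ.ex b (Λ.pw (comp g P) b k) ≠ 0 := by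
          rw [Λ.ex_pw _ _ hb, ih hv hb, he]; omega
        rw [ex_eq_zero_of_not_full (hf P hb) hb ha (Ne.symm hab) this]
        simp [expo, hab]
    · rw [comp_sing_of_not_mem hb, ex_one ha]
      have hab : a ≠ b := fun h => hb (h ▸ ha)
      simp [expo, hab]
  | full g Q d ih =>
    by_cases hQP : Q = P
    · subst hQP
      rw [comp_full_self]
      simp [expo, ha]
    · by_cases h : ∃ c, Λ.Mem c Q ∧ Λ.Mem c P
      · obtain ⟨c, hcQ, hcP⟩ := h
        rw [comp_full_of_mem hQP hcQ hcP]
        by_cases hac : a = c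
        · subst hac
          rw [ex_pw_one_self ha]
          simp [expo, hcQ]
        · rw [ex_pw_one_of_ne (Ne.symm hac) hcP ha]
          have : ¬ Λ.Mem a Q := fun haQ => hQP (Λ.eq_of_mem hac haQ hcQ ha hcP)
          simp [expo, this]
      · rw [comp_full_of_disjoint hQP h, ex_one ha]
        have : ¬ Λ.Mem a Q := fun haQ => h ⟨a, haQ, ha⟩
        simp [expo, this]

lemma comp_eq_one {g : NF Λ} (hg : Valid g) (h : ∀ a, Λ.Mem a P → expo a g = 0) :
    comp g P = Λ.one P := by
  by_contra hne
  obtain ⟨a, ha, hex⟩ := Λ.exists_ex_ne hne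
  exact hex ((ex_comp hg ha).trans (h a ha))

lemma expo_of_comp_eq_one {g : NF Λ} (hg : Valid g) (h : comp g P = Λ.one P)
    (ha : Λ.Mem a P) : expo a g = 0 := by
  rw [← ex_comp hg ha, h, ex_one ha]

lemma res_eq_self {g : NF Λ} (hg : Valid g) (h : comp g P = Λ.one P) : res g P = g := by
  cases g with
  | nil => rfl
  | sing g b k =>
    obtain ⟨hv, hk, he, hf⟩ := hg
    by_cases hb : Λ.Mem b P
    · rw [comp_sing_of_mem hb] at h
      exact absurd h (pw_ne_one hb ((ex_comp hv hb).trans he) hk)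
    · exact res_sing_of_not_mem hb
  | full g Q d =>
    obtain ⟨hv, hf, hc⟩ := hg
    by_cases hQP : Q = P
    · subst hQP
      rw [comp_full_self] at h
      exact absurd (h ▸ hf) not_full_one
    · by_cases hQ_mem : ∃ c, Λ.Mem c Q ∧ Λ.Mem c P
      · obtain ⟨c, hcQ, hcP⟩ := hQ_mem
        rw [comp_full_of_mem hQP hcQ hcP] at h
        exact absurd h (pw_ne_one hcP (ex_one hcP) (hf c hcQ))
      · exact res_full_of_disjoint hQP hQ_mem

/-- A power of `a` can only be absorbed after a single syllable. -/
lemma exists_sing_of_full {g : NF Λ} (hg : Valid g) (ha : Λ.Mem a P) (he : expo a g = 0) {k : ℤ}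
    (hf : Λ.Full (Λ.pw (comp g P) a k)) :
    ∃ g' t l, g = sing g' t l ∧ t ≠ a ∧ Λ.Mem t P := by
  cases g with
  | nil => exact absurd hf (not_full_pw_one ha k)
  | sing g' t l =>
    by_cases ht : Λ.Mem t P
    · refine ⟨g', t, l, rfl, ?_, ht⟩
      rintro rfl
      exact hg.2.1 (by simpa [expo] using he)
    · rw [comp_sing_of_not_mem ht] at hf
      exact absurd hf (not_full_pw_one ha k)
  | full g' Q d =>
    have haQ : ¬ Λ.Mem a Q := fun haQ => hg.2.1 a haQ (by simpa [expo, haQ] using he)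
    have hQP : Q ≠ P := fun h => haQ (h ▸ ha)
    by_cases h' : ∃ c, Λ.Mem c Q ∧ Λ.Mem c P
    · obtain ⟨c, hcQ, hcP⟩ := h'
      rw [comp_full_of_mem hQP hcQ hcP] at hf
      exact absurd hf (not_full_pw_pw (by rintro rfl; exact haQ hcQ) ha hcP _ _)
    · rw [comp_full_of_disjoint hQP h'] at hf
      exact absurd hf (not_full_pw_one ha k)

lemma push_of_full {g : NF Λ} (hg : Valid g) (ha : Λ.Mem a P) (he : expo a g = 0) {k : ℤ}
    (hf : Λ.Full (Λ.pw (comp g P) a k)) :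
    push g a k = full (res g P) P (Λ.pw (comp g P) a k) := by
  have h : ∃ P, Λ.Mem a P ∧ Λ.Full (Λ.pw (comp g P) a k) := ⟨P, ha, hf⟩
  have hc : h.choose = P := by
    obtain ⟨g', t, l, rfl, hta, ht⟩ := exists_sing_of_full hg ha he hf
    obtain ⟨g'', t', l', heq, hta', ht'⟩ :=
      exists_sing_of_full hg h.choose_spec.1 he h.choose_spec.2
    cases heq
    exact Λ.eq_of_mem hta ht' h.choose_spec.1 ht ha
  rw [push, pushAux, dif_pos h, hc]

lemma push_of_not_full {g : NF Λ} {k : ℤ}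
    (hf : ∀ P, Λ.Mem a P → ¬ Λ.Full (Λ.pw (comp g P) a k)) : push g a k = sing g a k := by
  rw [push, pushAux, dif_neg]
  rintro ⟨P, h1, h2⟩
  exact hf P h1 h2

/-- The `P`-component can be split off and appended again. -/
def Splits (g : NF Λ) : Prop :=
  ∀ P, Valid (res g P) ∧ comp (res g P) P = Λ.one P ∧ star (res g P) P (comp g P) = g ∧
    size g = size (res g P) + Λ.len (comp g P) ∧ eval g = eval (res g P) * Λ.ev (comp g P)

lemma star_spec {g : NF Λ} (hg : Valid g) (hs : Splits g) (hc : comp g P = Λ.one P)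
    (d : Λ.D P) : Valid (star g P d) ∧ comp (star g P d) P = d ∧ res (star g P d) P = g ∧
      size (star g P d) = size g + Λ.len d ∧ eval (star g P d) = eval g * Λ.ev d := by
  induction d using D_induction with
  | one =>
    rw [star_one, Λ.len_one, Λ.ev_one, mul_one, add_zero]
    exact ⟨hg, hc, res_eq_self hg hc, rfl, rfl⟩
  | pw d b k hb hd hk ih =>
    by_cases hf : Λ.Full (Λ.pw d b k)
    · rw [star_full g hf]
      exact ⟨⟨hg, hf, hc⟩, comp_full_self, res_full_self, rfl, rfl⟩
    rw [star_pw g hb hd hk hf, len_pw hb hd, Λ.ev_pw _ _ hb]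
    split_ifs with h1
    · subst h1
      have he : expo b g = 0 := expo_of_comp_eq_one hg hc hb
      rw [Λ.len_one, Λ.ev_one, one_mul, zero_add]
      by_cases hm : ∃ P', Λ.Mem b P' ∧ Λ.Full (Λ.pw (comp g P') b k)
      · obtain ⟨P', hb', hf'⟩ := hm
        obtain ⟨h1, h2, h3, h4, h5⟩ := hs P'
        have hPP : P' ≠ P := by
          rintro rfl
          rw [hc] at hf'
          exact hf hf'
        have hex : Λ.ex b (comp g P') = 0 := (ex_comp hg hb').trans he
        have hex' : Λ.ex b (Λ.pw (comp g P') b k) = k := by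
          rw [Λ.ex_pw _ _ hb', hex, zero_add]
        rw [push_of_full hg hb' he hf']
        refine ⟨⟨h1, hf', h2⟩, ?_, ?_, ?_, ?_⟩
        · rw [comp_full_of_mem hPP hb' hb, hex']
        · rw [res_full_of_mem hPP hb' hb, hex', Λ.pw_pw, add_neg_cancel, Λ.pw_zero, h3]
        · rw [size, len_pw hb' hex, h4]; ring
        · rw [eval, Λ.ev_pw _ _ hb', h5, mul_assoc]
      · push Not at hm
        rw [push_of_not_full hm]
        refine ⟨⟨hg, hk, he, hm⟩, ?_, ?_, rfl, rfl⟩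
        · rw [comp_sing_of_mem hb, hc]
        · rw [res_sing_of_mem hb, res_eq_self hg hc]
    · obtain ⟨i1, i2, i3, i4, i5⟩ := ih
      obtain ⟨c, hcP, hcd⟩ := Λ.exists_ex_ne h1
      have hcb : c ≠ b := fun h => hcd (h ▸ hd)
      have hdf : ¬ Λ.Full d := fun h => h b hb hd
      refine ⟨⟨i1, hk, ?_, ?_⟩, ?_, ?_, ?_, ?_⟩
      · rw [← ex_comp i1 hb, i2, hd]
      · intro P' hb' hf'
        by_cases hPP : P' = P
        · subst hPP
          rw [i2] at hf'
          exact hf hf'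
        have hcP' : ¬ Λ.Mem c P' := fun h => hPP (Λ.eq_of_mem hcb h hb' hcP hb)
        obtain ⟨g', t, l, ht, htb, htP⟩ := exists_sing_of_full i1 hb'
          (by rw [← ex_comp i1 hb, i2, hd]) hf'
        have hexc : expo c (star g P d) ≠ 0 := by rwa [← ex_comp i1 hcP, i2]
        rw [ht] at hexc
        by_cases hct : c = t
        · exact hcP' (hct ▸ htP)
        · simp [expo, hct] at hexc
      · rw [comp_sing_of_mem hb, i2]
      · rw [res_sing_of_mem hb, i3]
      · rw [size, i4, add_assoc]
      · rw [eval, i5, mul_assoc]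

lemma comp_star_of_full {g : NF Λ} (hg : Valid g) (hs : Splits g) (hc : comp g Q = Λ.one Q)
    {d : Λ.D Q} (hd : Λ.Full d) (hQP : Q ≠ P) (haQ : Λ.Mem a Q) (haP : Λ.Mem a P) :
    comp (star g Q (Λ.pw d a (-Λ.ex a d))) P = Λ.one P := by
  obtain ⟨i1, i2, -⟩ := star_spec hg hs hc (Λ.pw d a (-Λ.ex a d))
  obtain ⟨b, hba, hb⟩ := Λ.exists_other haQ
  set e := Λ.pw d a (-Λ.ex a d) with he
  have hea : Λ.ex a e = 0 := ex_pw_neg_ex d haQ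
  have hd' : Λ.pw e a (Λ.ex a d) = d := pw_neg_ex d a
  have hf : ¬ Λ.Full e := fun h => h a haQ hea
  have h1 : e ≠ Λ.one Q := fun h => not_full_pw_one haQ (Λ.ex a d) (by rwa [← h, hd'])
  have hbe : Λ.ex b e ≠ 0 := by
    obtain ⟨c, hcQ, hce⟩ := Λ.exists_ex_ne h1
    rcases Λ.eq_or_eq hba hb haQ hcQ with rfl | rfl
    · exact hce
    · exact absurd hea hce
  have hbP : ¬ Λ.Mem b P := fun h => hQP (Λ.eq_of_mem hba hb haQ h haP)
  have h2 : Λ.pw e b (-Λ.ex b e) ≠ Λ.one Q := by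
    intro h
    have : e = Λ.pw (Λ.one Q) b (Λ.ex b e) := by rw [← h, pw_neg_ex]
    rw [this] at hd'
    exact not_full_pw_pw hba.symm haQ hb _ _ (hd'.symm ▸ hd)
  have h3 := star_pw g (d := Λ.pw e b (-Λ.ex b e)) hb (ex_pw_neg_ex e hb) hbe
    (by rwa [pw_neg_ex])
  rw [pw_neg_ex, if_neg h2] at h3
  rw [h3, comp_sing_of_not_mem hbP]

lemma push_star {g : NF Λ} (hg : Valid g) (hs : Splits g) (hc : comp g P = Λ.one P)
    (ha : Λ.Mem a P) {d : Λ.D P} (hd : Λ.ex a d = 0) {k : ℤ} (hk : k ≠ 0) :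
    push (star g P d) a k = star g P (Λ.pw d a k) := by
  obtain ⟨i1, i2, i3, -⟩ := star_spec hg hs hc d
  have he : expo a (star g P d) = 0 := by rw [← ex_comp i1 ha, i2, hd]
  by_cases hf : Λ.Full (Λ.pw d a k)
  · rw [push_of_full (P := P) i1 ha he (by rwa [i2]), i2, i3, star_full g hf]
  · have h := star_pw g ha hd hk hf
    rw [h]
    split_ifs with h1
    · rw [h1, star_one]
    · have hv := (star_spec hg hs hc (Λ.pw d a k)).1
      rw [h, if_neg h1] at hv
      exact push_of_not_full hv.2.2.2

lemma splits {g : NF Λ} (hg : Valid g) : Splits g := by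
  induction g with
  | nil =>
    intro P
    refine ⟨trivial, rfl, star_one _ _, ?_, ?_⟩
    · simp [res, comp, size, Λ.len_one]
    · simp [res, comp, eval, Λ.ev_one]
  | sing g b k ih =>
    obtain ⟨hv, hk, he, hf⟩ := hg
    intro P
    by_cases hb : Λ.Mem b P
    · obtain ⟨h1, h2, h3, h4, h5⟩ := ih hv P
      have hex : Λ.ex b (comp g P) = 0 := (ex_comp hv hb).trans he
      rw [comp_sing_of_mem hb, res_sing_of_mem hb]
      refine ⟨h1, h2, ?_, ?_, ?_⟩
      · rw [star_pw _ hb hex hk (hf P hb)]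
        split_ifs with h
        · rw [res_eq_self hv h, push_of_not_full hf]
        · rw [h3]
      · rw [len_pw hb hex, size, h4, add_assoc]
      · rw [Λ.ev_pw _ _ hb, eval, h5, mul_assoc]
    · rw [comp_sing_of_not_mem hb, res_sing_of_not_mem hb, Λ.len_one, Λ.ev_one, star_one]
      exact ⟨⟨hv, hk, he, hf⟩, comp_sing_of_not_mem hb, rfl, rfl, (mul_one _).symm⟩
  | full g Q d ih =>
    obtain ⟨hv, hf, hc⟩ := hg
    intro P
    by_cases hQP : Q = P
    · subst hQP
      rw [comp_full_self, res_full_self]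
      exact ⟨hv, hc, star_full g hf, rfl, rfl⟩
    by_cases h : ∃ a, Λ.Mem a Q ∧ Λ.Mem a P
    · obtain ⟨a, haQ, haP⟩ := h
      obtain ⟨i1, i2, i3, i4, i5⟩ := star_spec hv (ih hv) hc (Λ.pw d a (-Λ.ex a d))
      have hcP := comp_star_of_full hv (ih hv) hc hf hQP haQ haP
      rw [comp_full_of_mem hQP haQ haP, res_full_of_mem hQP haQ haP]
      refine ⟨i1, hcP, ?_, ?_, ?_⟩
      · rw [star_pw _ haP (ex_one haP) (hf a haQ) (not_full_pw_one haP _), if_pos rfl,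
          push_star hv (ih hv) hc haQ (ex_pw_neg_ex d haQ) (hf a haQ), pw_neg_ex, star_full g hf]
      · rw [len_pw haP (ex_one haP), Λ.len_one, i4, size, Λ.len_eq d haQ]; ring
      · rw [Λ.ev_pw _ _ haP, Λ.ev_one, one_mul, i5, eval, Λ.ev_pw _ _ haQ]
        group
    · rw [comp_full_of_disjoint hQP h, res_full_of_disjoint hQP h, Λ.len_one, Λ.ev_one, star_one]
      exact ⟨⟨hv, hf, hc⟩, comp_full_of_disjoint hQP h, rfl, rfl, (mul_one _).symm⟩

/-- Append `a ^ k`, with `k = 0` allowed. -/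
noncomputable def append (h : NF Λ) (a : S) (k : ℤ) : NF Λ := if k = 0 then h else push h a k

/-- Remove the maximal power of `a` at the end. -/
noncomputable def strip (a : S) : NF Λ → NF Λ
  | nil => nil
  | sing g b k => if a = b then g else sing g b k
  | full g Q d => if Λ.Mem a Q then star g Q (Λ.pw d a (-Λ.ex a d)) else full g Q d

/-- The right action of `a ^ n` on normal forms. -/
noncomputable def act (a : S) (n : ℤ) (h : NF Λ) : NF Λ := append (strip a h) a (expo a h + n)

lemma append_zero (h : NF Λ) (a : S) : append h a 0 = h := if_pos rfl

lemma append_of_ne (h : NF Λ) (a : S) {k : ℤ} (hk : k ≠ 0) : append h a k = push h a k := if_neg hk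

lemma append_star {g : NF Λ} (hg : Valid g) (hc : comp g P = Λ.one P) (ha : Λ.Mem a P)
    {d : Λ.D P} (hd : Λ.ex a d = 0) (k : ℤ) :
    append (star g P d) a k = star g P (Λ.pw d a k) := by
  by_cases hk : k = 0
  · rw [hk, append_zero, Λ.pw_zero]
  · rw [append_of_ne _ _ hk, push_star hg (splits hg) hc ha hd hk]

lemma strip_spec {h : NF Λ} (hh : Valid h) (a : S) :
    Valid (strip a h) ∧ expo a (strip a h) = 0 ∧ append (strip a h) a (expo a h) = h := by
  cases h with
  | nil => exact ⟨trivial, rfl, append_zero _ _⟩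
  | sing g b k =>
    by_cases hab : a = b
    · subst hab
      obtain ⟨hv, hk, he, hf⟩ := hh
      simp only [strip, expo, if_true]
      exact ⟨hv, he, by rw [append_of_ne _ _ hk, push_of_not_full hf]⟩
    · simp only [strip, expo, if_neg hab, append_zero]
      exact ⟨hh, trivial, trivial⟩
  | full g Q d =>
    obtain ⟨hv, hf, hc⟩ := hh
    by_cases ha : Λ.Mem a Q
    · simp only [strip, expo, if_pos ha]
      obtain ⟨i1, i2, -⟩ := star_spec hv (splits hv) hc (Λ.pw d a (-Λ.ex a d))
      refine ⟨i1, ?_, ?_⟩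
      · exact (ex_comp i1 ha).symm.trans (by rw [i2, ex_pw_neg_ex d ha])
      · rw [append_star hv hc ha (ex_pw_neg_ex d ha), pw_neg_ex, star_full g hf]
    · simp only [strip, expo, if_neg ha, append_zero]
      exact ⟨⟨hv, hf, hc⟩, trivial, trivial⟩

lemma strip_eq_self {h : NF Λ} (hh : Valid h) (he : expo a h = 0) : strip a h = h := by
  have := (strip_spec hh a).2.2
  rwa [he, append_zero] at this

lemma append_spec {h : NF Λ} (hh : Valid h) (he : expo a h = 0) (k : ℤ) :
    Valid (append h a k) ∧ strip a (append h a k) = h ∧ expo a (append h a k) = k ∧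
      size (append h a k) = size h + k.natAbs ∧ eval (append h a k) = eval h * gen a ^ k := by
  by_cases hk : k = 0
  · subst hk
    rw [append_zero]
    exact ⟨hh, strip_eq_self hh he, he, by simp, by simp⟩
  rw [append_of_ne _ _ hk]
  by_cases hm : ∃ P, Λ.Mem a P ∧ Λ.Full (Λ.pw (comp h P) a k)
  · obtain ⟨P, ha, hf⟩ := hm
    obtain ⟨h1, h2, h3, h4, h5⟩ := splits hh P
    have hex : Λ.ex a (comp h P) = 0 := (ex_comp hh ha).trans he
    have hex' : Λ.ex a (Λ.pw (comp h P) a k) = k := by rw [Λ.ex_pw _ _ ha, hex, zero_add]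
    rw [push_of_full hh ha he hf]
    refine ⟨⟨h1, hf, h2⟩, ?_, ?_, ?_, ?_⟩
    · simp only [strip, if_pos ha, hex', Λ.pw_pw, add_neg_cancel, Λ.pw_zero, h3]
    · simp only [expo, if_pos ha, hex']
    · rw [size, len_pw ha hex, h4]; ring
    · rw [eval, Λ.ev_pw _ _ ha, h5, mul_assoc]
  · push Not at hm
    rw [push_of_not_full hm]
    exact ⟨⟨hh, hk, he, hm⟩, by simp [strip], by simp [expo], rfl, rfl⟩

lemma size_eq {h : NF Λ} (hh : Valid h) (a : S) :
    size h = size (strip a h) + (expo a h).natAbs := by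
  obtain ⟨h1, h2, h3⟩ := strip_spec hh a
  have := (append_spec h1 h2 (expo a h)).2.2.2.1
  rwa [h3] at this

lemma eval_eq {h : NF Λ} (hh : Valid h) (a : S) :
    eval h = eval (strip a h) * gen a ^ expo a h := by
  obtain ⟨h1, h2, h3⟩ := strip_spec hh a
  have := (append_spec h1 h2 (expo a h)).2.2.2.2
  rwa [h3] at this

lemma valid_act {h : NF Λ} (hh : Valid h) (a : S) (n : ℤ) : Valid (act a n h) := by
  obtain ⟨h1, h2, -⟩ := strip_spec hh a
  exact (append_spec h1 h2 _).1

lemma strip_act {h : NF Λ} (hh : Valid h) (a : S) (n : ℤ) : strip a (act a n h) = strip a h := by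
  obtain ⟨h1, h2, -⟩ := strip_spec hh a
  exact (append_spec h1 h2 _).2.1

lemma expo_act {h : NF Λ} (hh : Valid h) (a : S) (n : ℤ) :
    expo a (act a n h) = expo a h + n := by
  obtain ⟨h1, h2, -⟩ := strip_spec hh a
  exact (append_spec h1 h2 _).2.2.1

lemma size_act {h : NF Λ} (hh : Valid h) (a : S) (n : ℤ) :
    size (act a n h) + (expo a h).natAbs = size h + (expo a h + n).natAbs := by
  rw [size_eq (valid_act hh a n) a, strip_act hh, expo_act hh, size_eq hh a]
  ring

lemma eval_act {h : NF Λ} (hh : Valid h) (a : S) (n : ℤ) :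
    eval (act a n h) = eval h * gen a ^ n := by
  rw [eval_eq (valid_act hh a n) a, strip_act hh, expo_act hh, eval_eq hh a, zpow_add, mul_assoc]

lemma act_zero {h : NF Λ} (hh : Valid h) (a : S) : act a 0 h = h := by
  rw [act, add_zero, (strip_spec hh a).2.2]

lemma act_act {h : NF Λ} (hh : Valid h) (a : S) (m n : ℤ) :
    act a n (act a m h) = act a (m + n) h := by
  rw [act, strip_act hh, expo_act hh, act, add_assoc]

lemma act_star {g : NF Λ} (hg : Valid g) (hc : comp g P = Λ.one P) (ha : Λ.Mem a P)
    (d : Λ.D P) (n : ℤ) : act a n (star g P d) = star g P (Λ.pw d a n) := by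
  have h0 := ex_pw_neg_ex d ha
  obtain ⟨i1, i2, -⟩ := star_spec hg (splits hg) hc (Λ.pw d a (-Λ.ex a d))
  have he : expo a (star g P (Λ.pw d a (-Λ.ex a d))) = 0 := by rw [← ex_comp i1 ha, i2, h0]
  have h1 := append_star hg hc ha h0 (Λ.ex a d)
  rw [pw_neg_ex] at h1
  obtain ⟨-, j2, j3, -⟩ := append_spec i1 he (Λ.ex a d)
  rw [act, ← h1, j2, j3, append_star hg hc ha h0, Λ.pw_pw, neg_add_cancel_left]

/-- All syllables of the normal form are over `T`. -/
def Over (T : Set S) : NF Λ → Prop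
  | nil => True
  | sing g a _ => Over T g ∧ a ∈ T
  | full g P _ => Over T g ∧ ∀ a, Λ.Mem a P → a ∈ T

variable {T : Set S}

lemma over_push {g : NF Λ} (hv : Valid g) (hg : Over T g) (hr : ∀ P, Over T (res g P))
    (he : expo a g = 0) (ha : a ∈ T) (k : ℤ) : Over T (push g a k) := by
  by_cases hm : ∃ P, Λ.Mem a P ∧ Λ.Full (Λ.pw (comp g P) a k)
  · obtain ⟨P, haP, hf⟩ := hm
    rw [push_of_full hv haP he hf]
    refine ⟨hr P, fun c hc => ?_⟩
    obtain ⟨g', t, l, rfl, hta, htP⟩ := exists_sing_of_full hv haP he hf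
    rcases Λ.eq_or_eq hta htP haP hc with rfl | rfl
    · exact hg.2
    · exact ha
  · push Not at hm
    rw [push_of_not_full hm]
    exact ⟨hg, ha⟩

lemma over_star {g : NF Λ} (hv : Valid g) (hg : Over T g) (hr : ∀ P, Over T (res g P))
    (hc : comp g P = Λ.one P) (hP : ∀ a, Λ.Mem a P → a ∈ T) (d : Λ.D P) :
    Over T (star g P d) := by
  induction d using D_induction with
  | one => rwa [star_one]
  | pw d b k hb hd hk ih =>
    by_cases hf : Λ.Full (Λ.pw d b k)
    · rw [star_full g hf]
      exact ⟨hg, hP⟩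
    rw [star_pw g hb hd hk hf]
    split_ifs with h1
    · exact over_push hv hg hr (expo_of_comp_eq_one hv hc hb) (hP b hb) k
    · exact ⟨ih, hP b hb⟩

lemma over_res {g : NF Λ} (hv : Valid g) (hg : Over T g) (P : Λ.Pr) : Over T (res g P) := by
  induction g generalizing P with
  | nil => exact hg
  | sing g a k ih =>
    by_cases ha : Λ.Mem a P
    · rw [res_sing_of_mem ha]
      exact ih hv.1 hg.1 P
    · rwa [res_sing_of_not_mem ha]
  | full g Q d ih =>
    by_cases hQP : Q = P
    · subst hQP
      rw [res_full_self]
      exact hg.1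
    · by_cases h : ∃ a, Λ.Mem a Q ∧ Λ.Mem a P
      · obtain ⟨a, haQ, haP⟩ := h
        rw [res_full_of_mem hQP haQ haP]
        exact over_star hv.1 hg.1 (ih hv.1 hg.1) hv.2.2 hg.2 _
      · rwa [res_full_of_disjoint hQP h]

lemma over_strip {g : NF Λ} (hv : Valid g) (hg : Over T g) (a : S) : Over T (strip a g) := by
  cases g with
  | nil => exact hg
  | sing g b k =>
    rw [strip]
    split_ifs
    · exact hg.1
    · exact hg
  | full g Q d =>
    rw [strip]
    split_ifs
    · exact over_star hv.1 hg.1 (over_res hv.1 hg.1) hv.2.2 hg.2 _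
    · exact hg

lemma over_act {g : NF Λ} (hv : Valid g) (hg : Over T g) (ha : a ∈ T) (n : ℤ) :
    Over T (act a n g) := by
  obtain ⟨h1, h2, -⟩ := strip_spec hv a
  have h3 := over_strip hv hg a
  rw [act, append]
  split_ifs
  · exact h3
  · exact over_push h1 h3 (over_res h1 h3) h2 ha _

lemma mem_of_expo_ne {g : NF Λ} (hg : Over T g) (h : expo a g ≠ 0) : a ∈ T := by
  cases g with
  | nil => exact absurd rfl h
  | sing g b k =>
    by_cases hab : a = b
    · exact hab ▸ hg.2
    · simp [expo, hab] at h
  | full g Q d =>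
    by_cases ha : Λ.Mem a Q
    · exact hg.2 a ha
    · simp [expo, ha] at h

lemma exists_expo_ne {g : NF Λ} (hv : Valid g) (h : g ≠ nil) : ∃ a, expo a g ≠ 0 := by
  cases g with
  | nil => exact absurd rfl h
  | sing g b k => exact ⟨b, by simpa [expo] using hv.2.1⟩
  | full g Q d =>
    obtain ⟨a, ha⟩ := Λ.exists_mem Q
    exact ⟨a, by simpa [expo, ha] using hv.2.1 a ha⟩

lemma exists_mem_mem {g : NF Λ} (hab : a ≠ b) (ha : expo a g ≠ 0) (hb : expo b g ≠ 0) :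
    ∃ P, Λ.Mem a P ∧ Λ.Mem b P := by
  cases g with
  | nil => exact absurd rfl ha
  | sing g c k =>
    by_cases hac : a = c
    · have hbc : b ≠ c := fun h => hab (hac.trans h.symm)
      simp [expo, hbc] at hb
    · simp [expo, hac] at ha
  | full g Q d =>
    by_cases ha' : Λ.Mem a Q
    · by_cases hb' : Λ.Mem b Q
      · exact ⟨Q, ha', hb'⟩
      · simp [expo, hb'] at hb
    · simp [expo, ha'] at ha

end NF

end RankTwoSystem

/-! ### Translation length along an orbit -/

lemma exists_exponent {X : Type*} (σ : Equiv.Perm X) (ℓ : X → ℕ)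
    (hstep : ∀ d, ℓ (σ d) = ℓ d + 1 ∨ ℓ (σ d) + 1 = ℓ d)
    (hmono : ∀ d, ℓ (σ d) = ℓ d + 1 → ℓ (σ (σ d)) = ℓ (σ d) + 1) :
    ∃ ex : X → ℤ, (∀ d k, ex ((σ ^ k) d) = ex d + k) ∧
      ∀ d, ℓ d = ℓ ((σ ^ (-ex d)) d) + (ex d).natAbs := by
  have hc : ∀ d, ∃ c : ℤ, ∀ k : ℤ, ℓ ((σ ^ (c + k)) d) = ℓ ((σ ^ c) d) + k.natAbs := by
    intro d
    obtain ⟨c, hc⟩ : ∃ c : ℤ, ∀ k : ℤ, ℓ ((σ ^ c) d) ≤ ℓ ((σ ^ k) d) := by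
      obtain ⟨c, -, hc⟩ := exists_minimalFor_of_wellFoundedLT (fun _ : ℤ => True)
        (fun k => ℓ ((σ ^ k) d)) ⟨0, trivial⟩
      exact ⟨c, fun k => (le_total _ _).elim id (hc (j := k) trivial)⟩
    have hs : ∀ k : ℤ, (σ ^ (k + 1)) d = σ ((σ ^ k) d) := fun k => by
      rw [add_comm, zpow_add, zpow_one, Equiv.Perm.mul_apply]
    have hup : ∀ k : ℕ, ℓ ((σ ^ (c + k)) d) = ℓ ((σ ^ c) d) + k ∧
        ℓ ((σ ^ (c + k + 1)) d) = ℓ ((σ ^ (c + k)) d) + 1 := by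
      intro k
      induction k with
      | zero =>
        have := hc (c + 1)
        simp only [Nat.cast_zero, add_zero, true_and]
        rw [hs] at this ⊢
        rcases hstep ((σ ^ c) d) with h | h <;> omega
      | succ k ih =>
        push_cast
        rw [← add_assoc, hs (c + k + 1), hs (c + k), ← hs (c + k)]
        refine ⟨by omega, ?_⟩
        have h2 := ih.2
        rw [hs] at h2 ⊢
        exact hmono _ h2
    have hdown : ∀ k : ℕ, ℓ ((σ ^ (c - k)) d) = ℓ ((σ ^ c) d) + k ∧
        ℓ ((σ ^ (c - k - 1)) d) = ℓ ((σ ^ (c - k)) d) + 1 := by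
      have hs' : ∀ k : ℤ, (σ ^ k) d = σ ((σ ^ (k - 1)) d) := fun k => by rw [← hs, sub_add_cancel]
      intro k
      induction k with
      | zero =>
        have := hc (c - 1)
        simp only [Nat.cast_zero, add_zero, true_and, sub_zero]
        rw [hs' c] at this ⊢
        rcases hstep ((σ ^ (c - 1)) d) with h | h <;> omega
      | succ k ih =>
        push_cast
        rw [← sub_sub]
        refine ⟨by omega, ?_⟩
        rcases hstep ((σ ^ (c - k - 1 - 1)) d) with h | h
        · have h2 := hmono _ h
          rw [← hs', ← hs'] at h2
          omega
        · rw [← hs'] at h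
          exact h.symm
    refine ⟨c, fun k => ?_⟩
    obtain ⟨k, rfl | rfl⟩ := k.eq_nat_or_neg
    · rw [(hup k).1, Int.natAbs_natCast]
    · rw [← sub_eq_add_neg, (hdown k).1, Int.natAbs_neg, Int.natAbs_natCast]
  choose c hc using hc
  refine ⟨fun d => -c d, fun d k => ?_, fun d => ?_⟩
  · have h1 := hc d (c ((σ ^ k) d) + k - c d)
    have h2 := hc ((σ ^ k) d) (c d - k - c ((σ ^ k) d))
    rw [← Equiv.Perm.mul_apply, ← Equiv.Perm.mul_apply, ← zpow_add, ← zpow_add] at h2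
    rw [show c d + (c ((σ ^ k) d) + k - c d) = c ((σ ^ k) d) + k by ring] at h1
    rw [show c ((σ ^ k) d) + (c d - k - c ((σ ^ k) d)) + k = c d by ring] at h2
    simp only
    omega
  · have := hc d (-c d)
    rw [add_neg_cancel, zpow_zero, Equiv.Perm.one_apply] at this
    rw [neg_neg, this]

/-! ### A model of the dihedral Artin–Tits groups -/

/-- Normal forms of the elements of the dihedral Artin–Tits group with label `N + 3` and
generators indexed by `Bool`: `delta r` is the `r`-th power of the Garside element `Δ`, and
`piece r L j x` is the product of `Δ ^ r`, of simple elements whose lengths, read from right to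
left, are given by `L`, and of a last simple element of length `j + 1` ending with `x`; each
simple element begins with the letter which ends the preceding one. -/
inductive Dihedral (N : ℕ)
  | delta (r : ℤ) : Dihedral N
  | piece (r : ℤ) (L : List (Fin (N + 2))) (j : Fin (N + 2)) (x : Bool) : Dihedral N

namespace Dihedral

variable {N : ℕ}

/-- The normal form with exponent `r`, simple elements `L` and last letter `x`. -/
def ofList (r : ℤ) : List (Fin (N + 2)) → Bool → Dihedral N
  | [], _ => delta r
  | j :: L, x => piece r L j x

/-- Right multiplication by the generator `y`. -/
def up (y : Bool) : Dihedral N → Dihedral N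
  | delta r => piece r [] 0 y
  | piece r L j x =>
    if x = y then piece r (j :: L) 0 y
    else if h : j.1 + 1 < N + 2 then piece r L ⟨j.1 + 1, h⟩ y
    else ofList (r + 1) L x

/-- Right multiplication by the inverse of the generator `y`. -/
def down (y : Bool) : Dihedral N → Dihedral N
  | delta r => piece (r - 1) [] (Fin.last _) (!y)
  | piece r L j x =>
    if x = y then
      if j.1 = 0 then ofList r L y else piece r L ⟨j.1 - 1, by omega⟩ (!y)
    else piece (r - 1) (j :: L) (Fin.last _) x

lemma down_up (y : Bool) (d : Dihedral N) : down y (up y d) = d := by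
  cases d with
  | delta r => simp [up, down, ofList]
  | piece r L j x =>
    by_cases hxy : x = y
    · simp [up, down, hxy, ofList]
    · have hx : x = !y := by cases x <;> cases y <;> simp_all
      by_cases h : j.1 + 1 < N + 2
      · simp [up, down, h, hx]
      · have hj : j = Fin.last _ := Fin.ext (by simp; omega)
        cases L with
        | nil => simp [up, down, ofList, hx, hj]
        | cons i L => simp [up, down, ofList, hx, hj]

lemma up_down (y : Bool) (d : Dihedral N) : up y (down y d) = d := by
  cases d with
  | delta r => simp [up, down, ofList]
  | piece r L j x =>
    by_cases hxy : x = y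
    · subst hxy
      by_cases h : j.1 = 0
      · have hj : j = 0 := Fin.ext h
        cases L with
        | nil => simp [up, down, ofList, hj]
        | cons i L => simp [up, down, ofList, hj]
      · have h1 : j.1 - 1 + 1 < N + 2 := by omega
        have h2 : (⟨j.1 - 1 + 1, h1⟩ : Fin (N + 2)) = j := Fin.ext (by simp; omega)
        simp [up, down, h, h2, h1]
    · simp [up, down, hxy, ofList]

/-- Right multiplication by the generator `y`, as a permutation. -/
def gen (y : Bool) : Equiv.Perm (Dihedral N) := ⟨up y, down y, down_up y, up_down y⟩

@[simp] lemma gen_apply (y : Bool) (d : Dihedral N) : gen y d = up y d := rfl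

@[simp] lemma gen_symm_apply (y : Bool) (d : Dihedral N) : (gen y).symm d = down y d := rfl

/-- The exponent of `Δ`. -/
def rank : Dihedral N → ℤ
  | delta r => r
  | piece r _ _ _ => r

/-- The list of simple elements. -/
def pieces : Dihedral N → List (Fin (N + 2))
  | delta _ => []
  | piece _ L j _ => j :: L

/-- The coordinates whose absolute values sum up to the length. -/
def coord (d : Dihedral N) (i : ℕ) : ℤ := d.rank + (d.pieces.countP fun j => i ≤ j.1 : ℕ)

/-- The length of an element. -/
def length (d : Dihedral N) : ℕ := ∑ i ∈ Finset.range (N + 3), (d.coord i).natAbs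

/-- The coordinate increased by `up y`. -/
def upIdx (y : Bool) : Dihedral N → ℕ
  | delta _ => 0
  | piece _ _ j x => if x = y then 0 else j.1 + 1

/-- The coordinate decreased by `down y`. -/
def downIdx (y : Bool) : Dihedral N → ℕ
  | delta _ => N + 2
  | piece _ _ j x => if x = y then j.1 else N + 2

lemma upIdx_le (y : Bool) (d : Dihedral N) : d.upIdx y ≤ N + 2 := by
  cases d with
  | delta r => simp [upIdx]
  | piece r L j x => simp only [upIdx]; split_ifs <;> omega

lemma downIdx_le (y : Bool) (d : Dihedral N) : d.downIdx y ≤ N + 2 := by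
  cases d with
  | delta r => simp [downIdx]
  | piece r L j x => simp only [downIdx]; split_ifs <;> omega

lemma coord_antitone (d : Dihedral N) {i j : ℕ} (h : i ≤ j) : d.coord j ≤ d.coord i := by
  have : (d.pieces.countP fun k => j ≤ k.1) ≤ d.pieces.countP fun k => i ≤ k.1 :=
    List.countP_mono_left fun k _ hk => by simp at hk ⊢; omega
  simp only [coord]
  omega

lemma coord_ofList (r : ℤ) (L : List (Fin (N + 2))) (x : Bool) (i : ℕ) :
    (ofList r L x).coord i = r + (L.countP fun j => i ≤ j.1 : ℕ) := by
  cases L <;> rfl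

lemma coord_piece (r : ℤ) (L : List (Fin (N + 2))) (j : Fin (N + 2)) (x : Bool) (i : ℕ) :
    (piece r L j x).coord i =
      r + (L.countP fun j => i ≤ j.1 : ℕ) + if i ≤ j.1 then 1 else 0 := by
  simp only [coord, rank, pieces, List.countP_cons, decide_eq_true_eq]
  push_cast
  rw [add_assoc]

lemma coord_up (y : Bool) (d : Dihedral N) {i : ℕ} (hi : i ≤ N + 2) :
    (up y d).coord i = d.coord i + if i = d.upIdx y then 1 else 0 := by
  cases d with
  | delta r =>
    simp only [up, coord_piece, upIdx]
    simp only [coord, rank, pieces]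
    split_ifs <;> simp_all
  | piece r L j x =>
    simp only [up, upIdx]
    split_ifs <;> simp_all [coord_piece, coord_ofList, List.countP_cons] <;>
      (try split_ifs) <;> omega

lemma upIdx_up {y : Bool} {d : Dihedral N} (h : d.upIdx y ≠ N + 2) : (up y d).upIdx y = 0 := by
  cases d with
  | delta r => simp [up, upIdx]
  | piece r L j x =>
    simp only [up, upIdx] at h ⊢
    split_ifs at h ⊢ with h1 h2
    · simp
    · simp
    · omega

lemma upIdx_down (y : Bool) (d : Dihedral N) : (down y d).upIdx y = d.downIdx y := by
  cases d with
  | delta r => simp [down, upIdx, downIdx]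
  | piece r L j x =>
    simp only [down, downIdx]
    split_ifs with h1 h2
    · cases L <;> simp [ofList, upIdx, h2]
    · simp [upIdx]; omega
    · simp [upIdx, h1]

lemma coord_down (y : Bool) (d : Dihedral N) {i : ℕ} (hi : i ≤ N + 2) :
    (down y d).coord i = d.coord i - if i = d.downIdx y then 1 else 0 := by
  have := coord_up y (down y d) hi
  rw [up_down, upIdx_down] at this
  rw [this, add_sub_cancel_right]

lemma downIdx_down {y : Bool} {d : Dihedral N} (h : d.downIdx y ≠ 0) :
    (down y d).downIdx y = N + 2 := by
  cases d with
  | delta r => simp [down, downIdx]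
  | piece r L j x =>
    simp only [down, downIdx] at h ⊢
    split_ifs at h ⊢ with h1 h2
    · exact absurd h2 h
    · simp
    · simp [h1]

lemma length_up (y : Bool) (d : Dihedral N) :
    0 ≤ d.coord (d.upIdx y) ∧ (up y d).length = d.length + 1 ∨
      d.coord (d.upIdx y) < 0 ∧ (up y d).length + 1 = d.length := by
  have hm : d.upIdx y ∈ Finset.range (N + 3) :=
    Finset.mem_range.2 (Nat.lt_succ_of_le (upIdx_le y d))
  have h1 := coord_up y d (upIdx_le y d)
  rw [if_pos rfl] at h1
  have h2 : ∑ i ∈ (Finset.range (N + 3)).erase (d.upIdx y), ((up y d).coord i).natAbs =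
      ∑ i ∈ (Finset.range (N + 3)).erase (d.upIdx y), (d.coord i).natAbs := by
    refine Finset.sum_congr rfl fun i hi => ?_
    rw [Finset.mem_erase, Finset.mem_range] at hi
    rw [coord_up y d (by omega), if_neg hi.1, add_zero]
  rw [length, length, ← Finset.add_sum_erase _ _ hm, ← Finset.add_sum_erase _ _ hm, h2, h1]
  omega

lemma length_down (y : Bool) (d : Dihedral N) :
    d.coord (d.downIdx y) ≤ 0 ∧ (down y d).length = d.length + 1 ∨
      0 < d.coord (d.downIdx y) ∧ (down y d).length + 1 = d.length := by
  have h1 := length_up y (down y d)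
  rw [up_down, upIdx_down, coord_down y d (downIdx_le y d), if_pos rfl] at h1
  omega

lemma one_le_coord_up {y : Bool} {d : Dihedral N} (h : 0 ≤ d.coord (d.upIdx y)) :
    1 ≤ (up y d).coord ((up y d).upIdx y) := by
  have h1 := coord_up y d (upIdx_le y d)
  rw [if_pos rfl] at h1
  have h2 : (up y d).coord (d.upIdx y) ≤ (up y d).coord ((up y d).upIdx y) := by
    apply coord_antitone
    by_cases h3 : d.upIdx y = N + 2
    · rw [h3]; exact upIdx_le y _
    · rw [upIdx_up h3]; exact Nat.zero_le _
  omega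

lemma coord_down_le {y : Bool} {d : Dihedral N} (h : d.coord (d.downIdx y) ≤ 0) :
    (down y d).coord ((down y d).downIdx y) ≤ -1 := by
  have h1 := coord_down y d (downIdx_le y d)
  rw [if_pos rfl] at h1
  have h2 : (down y d).coord ((down y d).downIdx y) ≤ (down y d).coord (d.downIdx y) := by
    apply coord_antitone
    by_cases h3 : d.downIdx y = 0
    · rw [h3]; exact Nat.zero_le _
    · rw [downIdx_down h3]; exact downIdx_le y d
  omega

lemma exists_ex (N : ℕ) (y : Bool) : ∃ ex : Dihedral N → ℤ,
    (∀ d k, ex ((gen y ^ k : Equiv.Perm _) d) = ex d + k) ∧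
      ∀ d, d.length = ((gen y ^ (-ex d) : Equiv.Perm _) d).length + (ex d).natAbs := by
  apply exists_exponent
  · intro d
    have := length_up y d
    rw [gen_apply]
    tauto
  · intro d h
    rw [gen_apply] at h ⊢
    rcases length_up y d with h1 | h1
    · rcases length_up y (up y d) with h2 | h2
      · exact h2.2
      · have := one_le_coord_up h1.1
        omega
    · omega

/-- The exponent of the maximal power of the generator `y` at the end of `d`. -/
noncomputable def ex (y : Bool) (d : Dihedral N) : ℤ := (exists_ex N y).choose d

lemma ex_zpow (y : Bool) (d : Dihedral N) (k : ℤ) : ex y ((gen y ^ k) d) = ex y d + k :=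
  (exists_ex N y).choose_spec.1 d k

lemma length_eq (y : Bool) (d : Dihedral N) :
    d.length = ((gen y ^ (-ex y d)) d).length + (ex y d).natAbs :=
  (exists_ex N y).choose_spec.2 d

lemma length_zpow (y : Bool) (d : Dihedral N) (k : ℤ) :
    ((gen y ^ k) d).length + (ex y d).natAbs = d.length + (ex y d + k).natAbs := by
  rw [length_eq y ((gen y ^ k) d), length_eq y d, ex_zpow, ← Equiv.Perm.mul_apply, ← zpow_add]
  rw [show -(ex y d + k) + k = -ex y d by ring]
  ring

lemma coord_of_ex_eq_zero {y : Bool} {d : Dihedral N} (h : ex y d = 0) :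
    0 ≤ d.coord (d.upIdx y) ∧ d.coord (d.downIdx y) ≤ 0 := by
  have h1 := length_zpow y d 1
  have h2 := length_zpow y d (-1)
  rw [zpow_one, gen_apply, h] at h1
  rw [zpow_neg_one, Equiv.Perm.inv_def, gen_symm_apply, h] at h2
  have h3 := length_up y d
  have h4 := length_down y d
  simp at h1 h2
  omega

lemma coord_of_ex_ne_zero {y : Bool} {d : Dihedral N} (h : ex y d ≠ 0) :
    d.coord (d.upIdx y) < 0 ∨ 0 < d.coord (d.downIdx y) := by
  have h1 := length_zpow y d 1
  have h2 := length_zpow y d (-1)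
  rw [zpow_one, gen_apply] at h1
  rw [zpow_neg_one, Equiv.Perm.inv_def, gen_symm_apply] at h2
  have h3 := length_up y d
  have h4 := length_down y d
  omega

lemma length_delta_zero : (delta 0 : Dihedral N).length = 0 :=
  Finset.sum_eq_zero fun i _ => by simp [coord, rank, pieces]

lemma ex_delta_zero (y : Bool) : ex y (delta 0 : Dihedral N) = 0 := by
  have := length_eq y (delta 0 : Dihedral N)
  rw [length_delta_zero] at this
  omega

lemma exists_ex_ne {d : Dihedral N} (h : d ≠ delta 0) : ∃ y, ex y d ≠ 0 := by
  by_contra! hex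
  cases d with
  | delta r =>
    obtain ⟨h1, h2⟩ := coord_of_ex_eq_zero (hex true)
    simp only [coord, rank, pieces, List.countP_nil] at h1 h2
    exact h (by congr 1; omega)
  | piece r L j x =>
    have h1 := (coord_of_ex_eq_zero (hex (!x))).1
    have h2 := (coord_of_ex_eq_zero (hex x)).2
    have h4 := coord_antitone (ofList r L x) (show j.1 ≤ j.1 + 1 by omega)
    rw [coord_ofList, coord_ofList] at h4
    simp only [upIdx, downIdx, Bool.eq_not_self, if_false, if_true] at h1 h2
    rw [coord_piece] at h1 h2
    rw [if_neg (by omega)] at h1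
    rw [if_pos le_rfl] at h2
    omega

lemma coord_ne_zero {d : Dihedral N} (h : ∀ y, ex y d ≠ 0) {i : ℕ} (hi : i ≤ N + 2) :
    d.coord i ≠ 0 := by
  cases d with
  | delta r =>
    have := coord_of_ex_ne_zero (h true)
    simp only [coord, rank, pieces, List.countP_nil] at this ⊢
    omega
  | piece r L j x =>
    have h1 := coord_of_ex_ne_zero (h x)
    have h2 := coord_of_ex_ne_zero (h !x)
    simp only [upIdx, downIdx, Bool.eq_not_self, if_false, if_true] at h1 h2
    have h3 := coord_antitone (piece r L j x) hi
    have h4 := coord_antitone (piece r L j x) (Nat.zero_le i)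
    by_cases hij : i ≤ j.1
    · have h5 := coord_antitone (piece r L j x) hij
      omega
    · have h5 := coord_antitone (piece r L j x) (show j.1 + 1 ≤ i by omega)
      omega

lemma coord_pow_eq_zero {y : Bool} (k : ℕ) {d : Dihedral N} (h : 1 ≤ d.coord (d.upIdx y)) {i : ℕ}
    (hi : i ≤ N + 2) (h0 : d.coord i = 0) : ((gen y ^ k) d).coord i = 0 := by
  induction k generalizing d with
  | zero => exact h0
  | succ k ih =>
    rw [pow_succ, Equiv.Perm.mul_apply, gen_apply]
    refine ih (one_le_coord_up (by omega)) ?_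
    rw [coord_up y d hi, if_neg, h0, add_zero]
    rintro rfl
    omega

lemma coord_inv_pow_eq_zero {y : Bool} (k : ℕ) {d : Dihedral N} (h : d.coord (d.downIdx y) ≤ -1)
    {i : ℕ} (hi : i ≤ N + 2) (h0 : d.coord i = 0) : (((gen y)⁻¹ ^ k) d).coord i = 0 := by
  induction k generalizing d with
  | zero => exact h0
  | succ k ih =>
    rw [pow_succ, Equiv.Perm.mul_apply, Equiv.Perm.inv_def, gen_symm_apply]
    refine ih (coord_down_le (by omega)) ?_
    rw [coord_down y d hi, if_neg, h0, sub_zero]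
    rintro rfl
    omega

/-- Appending a power of a generator to an element not ending with it makes at most one of the
vanishing coordinates nonzero. -/
lemma coord_zpow_eq_zero {y : Bool} {d : Dihedral N} (h : ex y d = 0) (k : ℤ) :
    ∃ i₀, ∀ i ≤ N + 2, i ≠ i₀ → d.coord i = 0 → ((gen y ^ k) d).coord i = 0 := by
  obtain ⟨h1, h2⟩ := coord_of_ex_eq_zero h
  obtain ⟨k, rfl | rfl⟩ := k.eq_nat_or_neg
  · cases k with
    | zero => exact ⟨0, fun i _ _ h0 => h0⟩
    | succ k =>
      refine ⟨d.upIdx y, fun i hi hne h0 => ?_⟩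
      rw [zpow_natCast, pow_succ, Equiv.Perm.mul_apply, gen_apply]
      refine coord_pow_eq_zero k (one_le_coord_up h1) hi ?_
      rw [coord_up y d hi, if_neg hne, h0, add_zero]
  · cases k with
    | zero => exact ⟨0, fun i _ _ h0 => h0⟩
    | succ k =>
      refine ⟨d.downIdx y, fun i hi hne h0 => ?_⟩
      rw [zpow_neg, zpow_natCast, ← inv_pow, pow_succ, Equiv.Perm.mul_apply,
        Equiv.Perm.inv_def, gen_symm_apply]
      refine coord_inv_pow_eq_zero k (coord_down_le h2) hi ?_
      rw [coord_down y d hi, if_neg hne, h0, sub_zero]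

lemma ex_zpow_zpow {x y : Bool} (hxy : x ≠ y) (k l : ℤ)
    (h : ex x ((gen x ^ l) ((gen y ^ k) (delta 0 : Dihedral N))) ≠ 0) :
    ex y ((gen x ^ l) ((gen y ^ k) (delta 0 : Dihedral N))) = 0 := by
  have hb : ∀ z, z = x ∨ z = y := by
    clear h
    intro z
    cases x <;> cases y <;> cases z <;> simp_all
  have h0 : ∀ i, (delta 0 : Dihedral N).coord i = 0 := fun i => by simp [coord, rank, pieces]
  obtain ⟨i₀, hi₀⟩ := coord_zpow_eq_zero (ex_delta_zero (N := N) y) k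
  have key : ∃ i ≤ N + 2, ((gen x ^ l) ((gen y ^ k) (delta 0 : Dihedral N))).coord i = 0 := by
    by_cases hx : ex x ((gen y ^ k) (delta 0 : Dihedral N)) = 0
    · obtain ⟨i₁, hi₁⟩ := coord_zpow_eq_zero hx l
      obtain ⟨i, hi, h1, h2⟩ : ∃ i ≤ N + 2, i ≠ i₀ ∧ i ≠ i₁ := by
        by_cases a0 : 0 ≠ i₀ ∧ 0 ≠ i₁
        · exact ⟨0, by omega, a0⟩
        by_cases a1 : 1 ≠ i₀ ∧ 1 ≠ i₁
        · exact ⟨1, by omega, a1⟩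
        · exact ⟨2, by omega, by omega, by omega⟩
      exact ⟨i, hi, hi₁ i hi h2 (hi₀ i hi h1 (h0 i))⟩
    · exfalso
      obtain ⟨i, hi, h1⟩ : ∃ i ≤ N + 2, i ≠ i₀ := by
        by_cases a0 : 0 = i₀
        · exact ⟨1, by omega, by omega⟩
        · exact ⟨0, by omega, a0⟩
      by_cases hk : k = 0
      · rw [hk, zpow_zero, Equiv.Perm.one_apply] at hx
        exact hx (ex_delta_zero x)
      · refine coord_ne_zero (fun z => ?_) hi (hi₀ i hi h1 (h0 i))
        rcases hb z with rfl | rfl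
        · exact hx
        · rw [ex_zpow, ex_delta_zero, zero_add]
          exact hk
  by_contra hy
  obtain ⟨i, hi, h1⟩ := key
  refine coord_ne_zero (fun z => ?_) hi h1
  rcases hb z with rfl | rfl
  · exact h
  · exact hy

/-- Right multiplication by `k` alternating generators, the first of which is `y`. -/
def ups : Bool → ℕ → Dihedral N → Dihedral N
  | _, 0, d => d
  | y, k + 1, d => ups (!y) k (up y d)

lemma ups_add (y : Bool) (j k : ℕ) (d : Dihedral N) :
    ups y (j + k) d = ups (not^[j] y) k (ups y j d) := by
  induction j generalizing y d with
  | zero => rw [Nat.zero_add]; rfl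
  | succ j ih => rw [Nat.add_right_comm, ups, ih, Function.iterate_succ_apply]; rfl

lemma up_not_piece (r : ℤ) (L : List (Fin (N + 2))) (j : Fin (N + 2)) (x : Bool)
    (h : j.1 + 1 < N + 2) : up (!x) (piece r L j x) = piece r L ⟨j.1 + 1, h⟩ (!x) := by
  simp [up, h]

lemma up_ofList (r : ℤ) (L : List (Fin (N + 2))) (x : Bool) :
    up x (ofList r L x) = piece r L 0 x := by
  cases L <;> simp [ofList, up]

lemma ups_piece (r : ℤ) (L : List (Fin (N + 2))) (k : ℕ) (j : Fin (N + 2)) (x : Bool)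
    (h : j.1 + k < N + 2) :
    ups (!x) k (piece r L j x) = piece r L ⟨j.1 + k, h⟩ (not^[k] x) := by
  induction k generalizing j x with
  | zero => rfl
  | succ k ih =>
    rw [ups, up_not_piece r L j x (by omega), ih _ _ (by simp; omega), Function.iterate_succ_apply]
    congr 2
    simp; omega

lemma ups_piece_eq_ofList (r : ℤ) (L : List (Fin (N + 2))) (k : ℕ) (j : Fin (N + 2)) (x : Bool)
    (h : j.1 + k = N + 1) :
    ups (!x) (k + 1) (piece r L j x) = ofList (r + 1) L (not^[k] x) := by
  induction k generalizing j x with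
  | zero =>
    have : ¬ j.1 + 1 < N + 2 := by omega
    simp [ups, up, this]
  | succ k ih =>
    rw [ups, up_not_piece r L j x (by omega), ih _ _ (by simp; omega), Function.iterate_succ_apply]

lemma not_iterate_add_two (k : ℕ) (x : Bool) : not^[k + 2] x = not^[k] x := by
  simp [Function.iterate_succ_apply]

lemma not_iterate_add_self (k : ℕ) (x : Bool) : not^[k + k] x = x := by
  induction k with
  | zero => rfl
  | succ k ih => rw [show k + 1 + (k + 1) = k + k + 2 by ring, not_iterate_add_two, ih]

lemma ups_braid_piece (y : Bool) (r : ℤ) (L : List (Fin (N + 2))) (j : Fin (N + 2)) (x : Bool) :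
    ups y (N + 3) (piece r L j x) = ofList (r + 1) (j :: L) (not^[N + 1] x) := by
  by_cases hxy : y = x
  · subst hxy
    rw [ups]
    simp only [up, if_true]
    exact ups_piece_eq_ofList r (j :: L) (N + 1) 0 y (by simp)
  · obtain rfl : y = !x := by cases x <;> cases y <;> simp_all
    obtain ⟨k, hk⟩ : ∃ k, j.1 + k = N + 1 := ⟨N + 1 - j.1, by omega⟩
    have h1 : not^[k + 1] (!x) = not^[k] x := by
      rw [← Function.iterate_succ_apply, not_iterate_add_two]
    have h2 : (0 : Fin (N + 2)).1 + j.1 < N + 2 := by simp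
    rw [show N + 3 = k + 1 + (j.1 + 1) by omega, ups_add, ups_piece_eq_ofList r L k j x hk, h1,
      ups, up_ofList, ups_piece _ _ _ _ _ h2, ← Function.iterate_add_apply, hk]
    simp [ofList]

lemma ups_braid_delta (y : Bool) (r : ℤ) : ups y (N + 3) (delta r : Dihedral N) = delta (r + 1) :=
  ups_piece_eq_ofList r [] (N + 1) 0 y (by simp)

lemma ups_braid (x y : Bool) (d : Dihedral N) : ups x (N + 3) d = ups y (N + 3) d := by
  cases d with
  | delta r => rw [ups_braid_delta, ups_braid_delta]
  | piece r L j z => rw [ups_braid_piece, ups_braid_piece]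

section Evaluation

variable {G : Type*} [Group G] (g : Bool → G)

/-- The alternating product of `k` generators, the last of which is `x`. -/
def altProd (x : Bool) : ℕ → G
  | 0 => 1
  | k + 1 => altProd (!x) k * g x

lemma altProd_succ (x : Bool) (k : ℕ) : altProd g x (k + 1) = altProd g (!x) k * g x := rfl

lemma altProd_succ' (x : Bool) (k : ℕ) :
    altProd g x (k + 1) = g (not^[k] x) * altProd g x k := by
  induction k generalizing x with
  | zero => simp [altProd]
  | succ k ih => rw [altProd, ih, Function.iterate_succ_apply, mul_assoc]; rfl

/-- The product of simple elements of the given lengths, read from right to left, the last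
letter being `x`. -/
def evalList : List (Fin (N + 2)) → Bool → G
  | [], _ => 1
  | j :: L, x => evalList L (not^[j.1] x) * altProd g x (j.1 + 1)

/-- The evaluation of a normal form. -/
def eval : Dihedral N → G
  | delta r => altProd g true (N + 3) ^ r
  | piece r L j x => altProd g true (N + 3) ^ r * evalList g (j :: L) x

lemma eval_ofList (r : ℤ) (L : List (Fin (N + 2))) (x : Bool) :
    eval g (ofList r L x) = altProd g true (N + 3) ^ r * evalList g L x := by
  cases L <;> simp [ofList, eval, evalList]

variable {g} (hg : altProd g true (N + 3) = altProd g false (N + 3))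

include hg

lemma altProd_eq (x : Bool) : altProd g x (N + 3) = altProd g true (N + 3) := by
  cases x
  · exact hg.symm
  · rfl

lemma gen_mul_delta (x : Bool) :
    g x * altProd g true (N + 3) = altProd g true (N + 3) * g (not^[N + 1] x) := by
  have h := altProd_succ' g (not^[N + 1] x) (N + 3)
  rw [altProd_succ, altProd_eq hg, altProd_eq hg, ← Function.iterate_add_apply] at h
  rw [h, show N + 3 + (N + 1) = (N + 2) + (N + 2) by ring, not_iterate_add_self, altProd_eq hg (not^[N + 1] x)]

lemma altProd_mul_delta (k : ℕ) (x : Bool) :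
    altProd g x k * altProd g true (N + 3) =
      altProd g true (N + 3) * altProd g (not^[N + 1] x) k := by
  induction k generalizing x with
  | zero => simp [altProd]
  | succ k ih =>
    rw [altProd_succ g x, mul_assoc, gen_mul_delta hg, ← mul_assoc, ih, mul_assoc,
      altProd_succ g (not^[N + 1] x), ← Function.iterate_succ_apply, Function.iterate_succ_apply']

lemma evalList_mul_delta (L : List (Fin (N + 2))) (x : Bool) :
    evalList g L x * altProd g true (N + 3) =
      altProd g true (N + 3) * evalList g L (not^[N + 1] x) := by
  induction L generalizing x with
  | nil => simp [evalList]
  | cons j L ih =>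
    rw [evalList, mul_assoc, altProd_mul_delta hg, ← mul_assoc, ih, mul_assoc, evalList,
      ← Function.iterate_add_apply, ← Function.iterate_add_apply, Nat.add_comm (N + 1) j.1]

lemma eval_up (y : Bool) (d : Dihedral N) : eval g (up y d) = eval g d * g y := by
  cases d with
  | delta r => simp [up, eval, evalList, altProd]
  | piece r L j x =>
    by_cases hxy : x = y
    · simp [up, hxy, eval, evalList, altProd, mul_assoc]
    · obtain rfl : y = !x := by cases x <;> cases y <;> simp_all
      by_cases h : j.1 + 1 < N + 2
      · rw [up_not_piece r L j x h]
        simp only [eval, evalList]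
        rw [altProd_succ g (!x), Bool.not_not, Function.iterate_succ_apply, Bool.not_not]
        simp only [mul_assoc]
      · have hj : j.1 = N + 1 := by omega
        have h1 : up (!x) (piece r L j x) = ofList (r + 1) L x := by simp [up, h]
        have h2 : altProd g x (j.1 + 1) * g (!x) = altProd g true (N + 3) := by
          rw [← altProd_eq hg (!x), hj, altProd_succ g (!x), Bool.not_not]
        have h3 : not^[N + 1] (not^[N + 1] x) = x := by
          rw [← Function.iterate_add_apply, not_iterate_add_self]
        rw [h1, eval_ofList, eval, evalList, mul_assoc, mul_assoc, h2, evalList_mul_delta hg, hj, h3,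
          zpow_add, zpow_one, mul_assoc]

lemma eval_zpow (y : Bool) (d : Dihedral N) (k : ℤ) :
    eval g ((gen y ^ k) d) = eval g d * g y ^ k := by
  have h : ∀ d : Dihedral N, eval g ((gen y)⁻¹ d) = eval g d * (g y)⁻¹ := fun d => by
    rw [eq_mul_inv_iff_mul_eq, ← eval_up hg, ← gen_apply, Equiv.Perm.inv_def, Equiv.apply_symm_apply]
  induction k generalizing d with
  | zero => simp
  | succ k ih =>
    rw [zpow_add_one, Equiv.Perm.mul_apply, ih, gen_apply, eval_up hg, mul_assoc, mul_self_zpow]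
  | pred k ih =>
    rw [zpow_sub_one, Equiv.Perm.mul_apply, ih, h, mul_assoc, zpow_sub_one,
      ← zpow_neg_one (g y), ← zpow_add, ← zpow_add, add_comm]

end Evaluation

end Dihedral

section Words

variable {S : Type u} (A : ArtinData S)

/-- The class of a generator. -/
def generator (s : S) : ArtinGroup A := wbar A [(s, true)]

lemma wbar_append (u v : Word S) : wbar A (u ++ v) = wbar A u * wbar A v := by
  rw [wbar, wbar, wbar, ← map_mul, FreeGroup.mul_mk]

lemma wbar_nil : wbar A [] = 1 := by
  rw [wbar, ← FreeGroup.one_eq_mk, map_one]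

lemma wbar_letter (s : S) (b : Bool) :
    wbar A [(s, b)] = generator A s ^ (if b then 1 else -1 : ℤ) := by
  cases b
  · rw [generator, wbar, wbar, if_neg Bool.false_ne_true, zpow_neg_one, ← map_inv,
      FreeGroup.inv_mk]
    rfl
  · rw [if_pos rfl, zpow_one]; rfl

lemma wbar_surjective : Function.Surjective (wbar A) := fun g => by
  obtain ⟨x, rfl⟩ := PresentedGroup.mk_surjective _ g
  exact ⟨x.toWord, by rw [wbar, FreeGroup.mk_toWord]⟩

lemma wbar_altWord {s t : S} {k : ℕ} (hst : s ≠ t) (hk : A.m s t = k) :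
    wbar A (altWord s t k) = wbar A (altWord t s k) := by
  rw [← mul_inv_eq_one, wbar, wbar, ← map_inv, ← map_mul]
  exact PresentedGroup.one_of_mem ⟨_, _, ⟨s, t, k, hst, hk, rfl, rfl⟩, rfl⟩

/-- A pair of generators with finite label `label + 3`. -/
structure Edge where
  fst : S
  snd : S
  rel : WellOrderingRel fst snd
  label : ℕ
  m_eq : A.m fst snd = (label + 3 : ℕ)

namespace Edge

variable {A} (P : Edge A)

/-- The ends of an edge, indexed by `Bool`. -/
def elt (b : Bool) : S := if b then P.snd else P.fst

/-- Incidence of a generator and an edge. -/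
def Mem (a : S) : Prop := a = P.fst ∨ a = P.snd

/-- The index of an end of an edge. -/
noncomputable def bit (a : S) : Bool := decide (a = P.snd)

lemma fst_ne_snd : P.fst ≠ P.snd := fun h => by
  have := P.rel
  rw [h] at this
  exact irrefl_of WellOrderingRel _ this

lemma elt_bit {a : S} (ha : P.Mem a) : P.elt (P.bit a) = a := by
  rcases ha with rfl | rfl
  · simp [elt, bit, P.fst_ne_snd]
  · simp [elt, bit]

lemma bit_elt (b : Bool) : P.bit (P.elt b) = b := by
  cases b <;> simp [elt, bit, P.fst_ne_snd]

lemma mem_elt (b : Bool) : P.Mem (P.elt b) := by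
  cases b
  · exact Or.inl rfl
  · exact Or.inr rfl

lemma eq_of_mem {P Q : Edge A} {a b : S} (hab : a ≠ b) (haP : P.Mem a) (hbP : P.Mem b)
    (haQ : Q.Mem a) (hbQ : Q.Mem b) : P = Q := by
  obtain ⟨p, q, hpq, l, hl⟩ := P
  obtain ⟨p', q', hpq', l', hl'⟩ := Q
  have h : p = p' ∧ q = q' := by
    have := asymm_of (WellOrderingRel (α := S)) hpq
    simp only [Mem] at haP hbP haQ hbQ
    rcases haP with h1 | h1 <;> rcases hbP with h2 | h2 <;> rcases haQ with h3 | h3 <;>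
      rcases hbQ with h4 | h4 <;> first
      | exact absurd (h1.trans h2.symm) hab
      | exact absurd (h3.trans h4.symm) hab
      | exact ⟨h1.symm.trans h3, h2.symm.trans h4⟩
      | exact ⟨h2.symm.trans h4, h1.symm.trans h3⟩
      | grind
  obtain ⟨rfl, rfl⟩ := h
  rw [hl] at hl'
  obtain rfl : l = l' := by
    have := Nat.cast_inj.1 hl'
    omega
  rfl

lemma wbar_altWord_elt (y : Bool) (k : ℕ) : wbar A (altWord (P.elt y) (P.elt !y) (k + 1)) =
    Dihedral.altProd (fun b => generator A (P.elt b)) (not^[k] y) (k + 1) := by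
  induction k generalizing y with
  | zero => simp [altWord, Dihedral.altProd, generator]
  | succ k ih =>
    have h := ih (!y)
    rw [Bool.not_not] at h
    rw [altWord, ← List.singleton_append, wbar_append, h, Dihedral.altProd_succ' _ _ (k + 1),
      ← Function.iterate_add_apply, Dihedral.not_iterate_add_self, Function.iterate_succ_apply]
    rfl

lemma altProd_generator : Dihedral.altProd (fun b => generator A (P.elt b)) true (P.label + 3) =
    Dihedral.altProd (fun b => generator A (P.elt b)) false (P.label + 3) := by
  have h : ∀ x, Dihedral.altProd (fun b => generator A (P.elt b)) x (P.label + 3) =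
      wbar A (altWord (P.elt false) (P.elt true) (P.label + 3)) := fun x => by
    have h1 := P.wbar_altWord_elt (not^[P.label + 2] x) (P.label + 2)
    rw [← Function.iterate_add_apply, Dihedral.not_iterate_add_self] at h1
    rw [← h1]
    cases not^[P.label + 2] x
    · rfl
    · exact (wbar_altWord A P.fst_ne_snd P.m_eq).symm
  rw [h, h]

end Edge

/-- The system of dihedral pieces of an Artin–Tits group. -/
noncomputable def dihedralSystem : RankTwoSystem S (ArtinGroup A) (generator A) where
  Pr := Edge A
  Mem a P := P.Mem a
  eq_of_mem := Edge.eq_of_mem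
  eq_or_eq {a b c P} hab ha hb hc := by
    rcases ha with rfl | rfl <;> rcases hb with rfl | rfl <;> rcases hc with rfl | rfl <;> simp_all
  exists_mem P := ⟨P.fst, Or.inl rfl⟩
  exists_other {a P} ha := by
    rcases ha with rfl | rfl
    · exact ⟨P.snd, P.fst_ne_snd.symm, Or.inr rfl⟩
    · exact ⟨P.fst, P.fst_ne_snd, Or.inl rfl⟩
  D P := Dihedral P.label
  one _ := Dihedral.delta 0
  pw {P} d a k := (Dihedral.gen (P.bit a) ^ k : Equiv.Perm _) d
  ex {P} a d := Dihedral.ex (P.bit a) d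
  len d := Dihedral.length d
  ev {P} d := Dihedral.eval (fun b => generator A (P.elt b)) d
  pw_zero d a := rfl
  pw_pw d a k l := by rw [← Equiv.Perm.mul_apply, ← zpow_add, add_comm]
  ex_pw d k _ := Dihedral.ex_zpow _ d k
  len_eq d _ := Dihedral.length_eq _ d
  len_one P := Dihedral.length_delta_zero
  exists_ex_ne {P d} h := by
    obtain ⟨y, hy⟩ := Dihedral.exists_ex_ne h
    exact ⟨P.elt y, P.mem_elt y, by rwa [P.bit_elt]⟩
  large {P a b} k l hab ha hb h := by
    refine Dihedral.ex_zpow_zpow (fun h => hab ?_) k l h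
    rw [← P.elt_bit ha, h, P.elt_bit hb]
  ev_one P := by simp [Dihedral.eval]
  ev_pw {P a} d k ha := by
    rw [Dihedral.eval_zpow P.altProd_generator, P.elt_bit ha]

end Words

section Action

open RankTwoSystem

variable {S : Type u} (A : ArtinData S)

/-- The set on which the Artin–Tits group acts by right multiplication. -/
abbrev NormalForm : Type u := {h : NF (dihedralSystem A) // NF.Valid h}

/-- Right multiplication by a generator. -/
noncomputable def actPerm (a : S) : Equiv.Perm (NormalForm A) where
  toFun h := ⟨NF.act a 1 h.1, NF.valid_act h.2 a 1⟩
  invFun h := ⟨NF.act a (-1) h.1, NF.valid_act h.2 a (-1)⟩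
  left_inv h := Subtype.ext (by simp [NF.act_act h.2, NF.act_zero h.2])
  right_inv h := Subtype.ext (by simp [NF.act_act h.2, NF.act_zero h.2])

lemma actPerm_zpow (a : S) (n : ℤ) (h : NormalForm A) :
    ((actPerm A a ^ n) h).1 = NF.act a n h.1 := by
  induction n generalizing h with
  | zero => exact (NF.act_zero h.2 a).symm
  | succ k ih =>
    rw [zpow_add_one, Equiv.Perm.mul_apply, ih]
    refine (NF.act_act h.2 a 1 k).trans ?_
    rw [add_comm]
  | pred k ih =>
    rw [zpow_sub_one, Equiv.Perm.mul_apply, ih]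
    refine (NF.act_act h.2 a (-1) (-k)).trans ?_
    rw [add_comm, sub_eq_add_neg]

/-- The right action of the free group on normal forms. -/
noncomputable def freeAct : FreeGroup S →* (Equiv.Perm (NormalForm A))ᵐᵒᵖ :=
  FreeGroup.lift fun a => MulOpposite.op (actPerm A a)

lemma freeAct_altWord (P : Edge A) {g : NF (dihedralSystem A)} (hg : NF.Valid g)
    (hc : NF.comp g P = (dihedralSystem A).one P) (y : Bool) (k : ℕ) (d : Dihedral P.label)
    (h : NormalForm A) (hh : h.1 = NF.star g P d) :
    ((freeAct A (FreeGroup.mk (altWord (P.elt y) (P.elt !y) k))).unop h).1 =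
      NF.star g P (Dihedral.ups y k d) := by
  induction k generalizing y d h with
  | zero =>
    rw [altWord, ← FreeGroup.one_eq_mk, map_one]
    exact hh
  | succ k ih =>
    have h1 := ih (!y) (Dihedral.up y d) (actPerm A (P.elt y) h) (by
      have h2 := NF.act_star hg hc (P.mem_elt y) d 1
      rw [← hh] at h2
      refine h2.trans (congrArg (NF.star g P) ?_)
      change (Dihedral.gen (P.bit (P.elt y)) ^ (1 : ℤ) : Equiv.Perm _) d = _
      rw [P.bit_elt, zpow_one]
      rfl)
    rw [Bool.not_not] at h1
    rw [altWord, ← List.singleton_append, ← FreeGroup.mul_mk, map_mul, MulOpposite.unop_mul,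
      Equiv.Perm.mul_apply]
    have h3 : (freeAct A (FreeGroup.mk [(P.elt y, true)])).unop = actPerm A (P.elt y) := by
      simp [freeAct]
    rw [h3]
    exact h1

lemma exists_edge (hA : ∀ s t : S, s ≠ t → 3 ≤ A.m s t) {s t : S} {k : ℕ} (hst : s ≠ t)
    (hk : A.m s t = k) : ∃ (P : Edge A) (y : Bool), P.elt y = s ∧ P.elt (!y) = t ∧
      k = P.label + 3 := by
  have h3 : 3 ≤ k := by
    have := hA s t hst
    rw [hk] at this
    exact_mod_cast this
  obtain ⟨l, rfl⟩ := Nat.exists_eq_add_of_le' h3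
  rcases trichotomous_of WellOrderingRel s t with h | h | h
  · exact ⟨⟨s, t, h, l, hk⟩, false, rfl, rfl, rfl⟩
  · exact absurd h hst
  · exact ⟨⟨t, s, h, l, (A.symm t s).trans hk⟩, true, rfl, rfl, rfl⟩

lemma freeAct_rels (hA : ∀ s t : S, s ≠ t → 3 ≤ A.m s t) :
    ∀ r ∈ rels A, freeAct A r = 1 := by
  rintro r ⟨u, v, ⟨s, t, k, hst, hk, rfl, rfl⟩, rfl⟩
  obtain ⟨P, y, rfl, rfl, rfl⟩ := exists_edge A hA hst hk
  rw [map_mul, map_inv, mul_inv_eq_one]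
  refine MulOpposite.unop_injective (Equiv.ext fun h => Subtype.ext ?_)
  obtain ⟨h1, h2, h3, -⟩ := NF.splits h.2 P
  have h4 := freeAct_altWord A P h1 h2 (!y) (P.label + 3) (NF.comp h.1 P) h h3.symm
  rw [Bool.not_not] at h4
  refine (freeAct_altWord A P h1 h2 y (P.label + 3) (NF.comp h.1 P) h h3.symm).trans
    (Eq.trans ?_ h4.symm)
  exact congrArg (fun d : Dihedral P.label => NF.star (NF.res h.1 P) P d)
    (Dihedral.ups_braid y (!y) _)

variable {A} (hA : ∀ s t : S, s ≠ t → 3 ≤ A.m s t)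

/-- The right action of the Artin–Tits group on normal forms. -/
noncomputable def artinAct : ArtinGroup A →* (Equiv.Perm (NormalForm A))ᵐᵒᵖ :=
  PresentedGroup.toGroup (freeAct_rels A hA)

/-- The normal form of a group element. -/
noncomputable def nf (g : ArtinGroup A) : NF (dihedralSystem A) :=
  ((artinAct hA g).unop ⟨NF.nil, trivial⟩).1

lemma valid_nf (g : ArtinGroup A) : NF.Valid (nf hA g) :=
  ((artinAct hA g).unop ⟨NF.nil, trivial⟩).2

lemma nf_one : nf hA 1 = NF.nil := by rw [nf, map_one]; rfl

lemma artinAct_generator (s : S) :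
    artinAct hA (generator A s) = MulOpposite.op (actPerm A s) :=
  PresentedGroup.toGroup.of (freeAct_rels A hA)

lemma nf_mul_zpow (g : ArtinGroup A) (s : S) (n : ℤ) :
    nf hA (g * generator A s ^ n) = NF.act s n (nf hA g) := by
  rw [nf, map_mul, map_zpow, artinAct_generator, MulOpposite.unop_mul, Equiv.Perm.mul_apply,
    ← MulOpposite.op_zpow, MulOpposite.unop_op, actPerm_zpow]
  rfl

lemma eval_nf (g : ArtinGroup A) : NF.eval (nf hA g) = g := by
  obtain ⟨w, rfl⟩ := wbar_surjective A g
  induction w using List.reverseRecOn with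
  | nil => rw [wbar_nil, nf_one]; rfl
  | append_singleton w x ih =>
    rw [wbar_append, wbar_letter, nf_mul_zpow, NF.eval_act (valid_nf hA _), ih]

lemma nf_mul_ev {P : (dihedralSystem A).Pr} {g : ArtinGroup A}
    (hc : NF.comp (nf hA g) P = (dihedralSystem A).one P) (d : (dihedralSystem A).D P) :
    nf hA (g * (dihedralSystem A).ev d) = NF.star (nf hA g) P d := by
  induction d using D_induction with
  | one => rw [NF.star_one, (dihedralSystem A).ev_one, mul_one]
  | pw d a k ha _ _ ih =>
    rw [(dihedralSystem A).ev_pw d k ha, ← mul_assoc, nf_mul_zpow, ih,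
      NF.act_star (valid_nf hA g) hc ha]

lemma nf_eval {x : NF (dihedralSystem A)} (hx : NF.Valid x) : nf hA (NF.eval x) = x := by
  induction x with
  | nil => exact nf_one hA
  | sing g a k ih =>
    obtain ⟨hv, hk, he, hf⟩ := hx
    rw [NF.eval, nf_mul_zpow, ih hv, NF.act, NF.strip_eq_self hv he, he, zero_add,
      NF.append_of_ne _ _ hk, NF.push_of_not_full hf]
  | full g P d ih =>
    obtain ⟨hv, hd, hc⟩ := hx
    have hg := ih hv
    rw [NF.eval, nf_mul_ev hA (by rwa [hg]), hg, NF.star_full _ hd]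

lemma eq_one_of_size {g : ArtinGroup A} (h : NF.size (nf hA g) = 0) : g = 1 := by
  by_contra hg
  obtain ⟨a, ha⟩ := NF.exists_expo_ne (valid_nf hA g) fun h0 => hg (by
    rw [← eval_nf hA g, h0]; rfl)
  have := NF.size_eq (valid_nf hA g) a
  omega

lemma size_nf_wbar_le (w : Word S) : NF.size (nf hA (wbar A w)) ≤ w.length := by
  induction w using List.reverseRecOn with
  | nil => rw [wbar_nil, nf_one]; exact le_rfl
  | append_singleton w x ih =>
    rw [wbar_append, wbar_letter, nf_mul_zpow, List.length_append, List.length_singleton]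
    have := NF.size_act (valid_nf hA (wbar A w)) x.1 (if x.2 then 1 else -1)
    split_ifs at this ⊢ <;> omega

lemma exists_word (g : ArtinGroup A) :
    ∃ w : Word S, wbar A w = g ∧ w.length = NF.size (nf hA g) := by
  induction hn : NF.size (nf hA g) generalizing g with
  | zero => exact ⟨[], by rw [wbar_nil, eq_one_of_size hA hn], rfl⟩
  | succ n ih =>
    obtain ⟨a, ha⟩ := NF.exists_expo_ne (valid_nf hA g) fun h0 => by
      rw [h0] at hn
      exact absurd hn (by simp [NF.size])
    obtain ⟨b, hb⟩ : ∃ b : Bool, (NF.expo a (nf hA g) - if b then 1 else -1).natAbs + 1 =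
        (NF.expo a (nf hA g)).natAbs := by
      rcases lt_or_gt_of_ne ha with h | h
      · exact ⟨false, by simp; omega⟩
      · exact ⟨true, by simp; omega⟩
    have h1 := NF.size_act (valid_nf hA g) a (-if b then 1 else -1)
    rw [← sub_eq_add_neg] at h1
    obtain ⟨w, hw, hl⟩ := ih (g * generator A a ^ (-if b then 1 else -1 : ℤ)) (by
      rw [nf_mul_zpow]
      omega)
    refine ⟨w ++ [(a, b)], ?_, by rw [List.length_append, hl]; rfl⟩
    rw [wbar_append, hw, wbar_letter, mul_assoc, ← zpow_add, neg_add_cancel, zpow_zero, mul_one]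

lemma elLength_eq (g : ArtinGroup A) : elLength A g = NF.size (nf hA g) := by
  refine le_antisymm (Nat.sInf_le (exists_word hA g)) ?_
  obtain ⟨w, hw, hl⟩ := Nat.sInf_mem
    (s := {n | ∃ w : Word S, wbar A w = g ∧ w.length = n}) ⟨_, exists_word hA g⟩
  rw [elLength, ← hl, ← hw]
  exact size_nf_wbar_le hA w

lemma geodesic_iff (w : Word S) : Geodesic A w ↔ w.length = NF.size (nf hA (wbar A w)) := by
  constructor
  · intro h
    obtain ⟨v, hv, hl⟩ := exists_word hA (wbar A w)
    exact le_antisymm (hl ▸ h v hv) (size_nf_wbar_le hA w)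
  · intro h v hv
    rw [h, ← hv]
    exact size_nf_wbar_le hA v

lemma over_nf {T : Set S} {h : ArtinGroup A} (hh : h ∈ parab A T) : NF.Over T (nf hA h) := by
  induction hh using Subgroup.closure_induction_right with
  | one => rw [nf_one]; trivial
  | mul_right x hx y hy ih =>
    obtain ⟨s, hs, rfl⟩ := hy
    have := nf_mul_zpow hA x s 1
    rw [zpow_one] at this
    exact this ▸ NF.over_act (valid_nf hA x) ih hs 1
  | mul_inv_cancel x hx y hy ih =>
    obtain ⟨s, hs, rfl⟩ := hy
    have := nf_mul_zpow hA x s (-1)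
    rw [zpow_neg_one] at this
    exact this ▸ NF.over_act (valid_nf hA x) ih hs (-1)

lemma generator_zpow_mem {T : Set S} {s : S} (hs : s ∈ T) (n : ℤ) :
    generator A s ^ n ∈ parab A T := by
  have h : generator A s ∈ parab A T := Subgroup.subset_closure ⟨s, hs, rfl⟩
  exact zpow_mem h n

/-- Lengths add up when an element with no final power of a generator of `T` is multiplied by an
element over `T`. -/
lemma expo_mul_and_size_mul {T : Set S} {g : ArtinGroup A}
    (hg : ∀ s ∈ T, NF.expo s (nf hA g) = 0) {h : ArtinGroup A} (hh : NF.Over T (nf hA h)) :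
    (∀ s ∈ T, NF.expo s (nf hA (g * h)) = NF.expo s (nf hA h)) ∧
      NF.size (nf hA (g * h)) = NF.size (nf hA g) + NF.size (nf hA h) := by
  induction hn : NF.size (nf hA h) using Nat.strong_induction_on generalizing h with
  | _ n ih =>
    subst hn
    by_cases h1 : nf hA h = NF.nil
    · obtain rfl : h = 1 := eq_one_of_size hA (by rw [h1]; rfl)
      rw [mul_one, nf_one]
      exact ⟨hg, rfl⟩
    obtain ⟨a, ha⟩ := NF.exists_expo_ne (valid_nf hA h) h1
    have haT := NF.mem_of_expo_ne hh ha
    obtain ⟨x, hx⟩ : ∃ x, x * generator A a ^ NF.expo a (nf hA h) = h :=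
      ⟨_, inv_mul_cancel_right h _⟩
    have hx' : nf hA x = NF.act a (-NF.expo a (nf hA h)) (nf hA h) := by
      rw [← nf_mul_zpow, zpow_neg, ← eq_mul_inv_of_mul_eq hx]
    have e1 := NF.expo_act (valid_nf hA h) a (-NF.expo a (nf hA h))
    have e2 := NF.size_act (valid_nf hA h) a (-NF.expo a (nf hA h))
    rw [← hx', add_neg_cancel] at e1 e2
    have hxo : NF.Over T (nf hA x) := hx' ▸ NF.over_act (valid_nf hA h) hh haT _
    obtain ⟨i1, i2⟩ := ih _ (by omega) hxo rfl
    have hgh : nf hA (g * h) = NF.act a (NF.expo a (nf hA h)) (nf hA (g * x)) := by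
      rw [← nf_mul_zpow, mul_assoc, hx]
    have f1 := NF.expo_act (valid_nf hA (g * x)) a (NF.expo a (nf hA h))
    have f2 := NF.size_act (valid_nf hA (g * x)) a (NF.expo a (nf hA h))
    rw [← hgh, i1 a haT, e1, zero_add] at f1 f2
    refine ⟨fun s hs => ?_, by omega⟩
    by_cases hsa : s = a
    · rw [hsa, f1]
    by_contra hne
    obtain ⟨P, haP, hsP⟩ : ∃ P, (dihedralSystem A).Mem a P ∧ (dihedralSystem A).Mem s P := by
      by_cases h0 : NF.expo s (nf hA h) = 0
      · rw [h0] at hne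
        exact NF.exists_mem_mem (Ne.symm hsa) (f1.symm ▸ ha) hne
      · exact NF.exists_mem_mem (Ne.symm hsa) ha h0
    obtain ⟨r1, r2, r3, r4, r5⟩ := NF.splits (valid_nf hA h) P
    rw [eval_nf] at r5
    have hc := NF.ex_comp (valid_nf hA h) haP
    have hlen := (dihedralSystem A).len_eq (NF.comp (nf hA h) P) haP
    obtain ⟨p, hp⟩ : ∃ p, p = NF.eval (NF.res (nf hA h) P) := ⟨_, rfl⟩
    have hnp : nf hA p = NF.res (nf hA h) P := hp ▸ nf_eval hA r1
    obtain ⟨j1, -⟩ := ih (NF.size (nf hA p)) (by rw [hnp]; omega)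
      (hnp.symm ▸ NF.over_res (valid_nf hA h) hh P) rfl
    have hgp : NF.comp (nf hA (g * p)) P = (dihedralSystem A).one P := by
      refine NF.comp_eq_one (valid_nf hA _) fun b hb => ?_
      have hbT : b ∈ T := by
        rcases (dihedralSystem A).eq_or_eq (Ne.symm hsa) haP hsP hb with rfl | rfl
        · exact haT
        · exact hs
      rw [j1 b hbT, hnp]
      exact NF.expo_of_comp_eq_one r1 r2 hb
    have hstar := nf_mul_ev hA hgp (NF.comp (nf hA h) P)
    rw [mul_assoc, hp, ← r5, ← hp] at hstar
    obtain ⟨k1, k2, -⟩ := NF.star_spec (valid_nf hA (g * p)) (NF.splits (valid_nf hA _)) hgp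
      (NF.comp (nf hA h) P)
    apply hne
    rw [hstar, ← NF.ex_comp k1 hsP, k2, NF.ex_comp (valid_nf hA h) hsP]

lemma expo_eq_zero_of_minimal {T : Set S} {g₀ : ArtinGroup A}
    (hmin : ∀ x ∈ parab A T, elLength A g₀ ≤ elLength A (g₀ * x)) {s : S} (hs : s ∈ T) :
    NF.expo s (nf hA g₀) = 0 := by
  have h1 := hmin _ (generator_zpow_mem hs (-NF.expo s (nf hA g₀)))
  have h2 := NF.size_act (valid_nf hA g₀) s (-NF.expo s (nf hA g₀))
  rw [elLength_eq hA, elLength_eq hA, nf_mul_zpow] at h1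
  rw [add_neg_cancel] at h2
  omega

lemma size_mul_of_minimal {T : Set S} {g₀ h : ArtinGroup A}
    (hmin : ∀ x ∈ parab A T, elLength A g₀ ≤ elLength A (g₀ * x)) (hh : h ∈ parab A T) :
    NF.size (nf hA (g₀ * h)) = NF.size (nf hA g₀) + NF.size (nf hA h) :=
  (expo_mul_and_size_mul hA (fun _ hs => expo_eq_zero_of_minimal hA hmin hs) (over_nf hA hh)).2

end Action

/-- Proposition 4.1: in an Artin–Tits group of large type: (1) if `g₀` is of
minimal length in `g A_{S₀}` and `g = g₀ h` with `h ∈ A_{S₀}`, then for any geodesic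
representatives `w₀` of `g₀` and `z` of `h`, the word `w₀ z` is a geodesic representative of
`g`; (2) the coset `g A_{S₀}` contains a unique element of minimal length. -/
theorem stmt15 {S : Type*} [Finite S] (A : ArtinData S)
    (hlarge : ∀ s t : S, s ≠ t → 3 ≤ A.m s t)
    (S₀ : Set S) (g : ArtinGroup A) :
    (∀ g₀ h : ArtinGroup A, g⁻¹ * g₀ ∈ parab A S₀ →
      (∀ g' : ArtinGroup A, g⁻¹ * g' ∈ parab A S₀ → elLength A g₀ ≤ elLength A g') →
      h ∈ parab A S₀ → g = g₀ * h →
      ∀ w₀ z : Word S, Geodesic A w₀ → wbar A w₀ = g₀ → Geodesic A z → wbar A z = h →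
        Geodesic A (w₀ ++ z) ∧ wbar A (w₀ ++ z) = g) ∧
    (∃! g₀ : ArtinGroup A, g⁻¹ * g₀ ∈ parab A S₀ ∧
      ∀ g' : ArtinGroup A, g⁻¹ * g' ∈ parab A S₀ → elLength A g₀ ≤ elLength A g') := by
  have hmin : ∀ g₀ : ArtinGroup A, g⁻¹ * g₀ ∈ parab A S₀ →
      (∀ g' : ArtinGroup A, g⁻¹ * g' ∈ parab A S₀ → elLength A g₀ ≤ elLength A g') →
      ∀ x ∈ parab A S₀, elLength A g₀ ≤ elLength A (g₀ * x) := fun g₀ h₀ h x hx =>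
    h _ (by rw [← mul_assoc]; exact mul_mem h₀ hx)
  constructor
  · rintro g₀ h h₀ hm hh rfl w₀ z hw₀ rfl hz rfl
    refine ⟨?_, wbar_append A w₀ z⟩
    rw [geodesic_iff hlarge] at hw₀ hz ⊢
    rw [wbar_append, size_mul_of_minimal hlarge (hmin _ h₀ hm) hh, List.length_append, hw₀, hz]
  · obtain ⟨g₀, h₀, hm⟩ : ∃ g₀ : ArtinGroup A, g⁻¹ * g₀ ∈ parab A S₀ ∧
        ∀ g' : ArtinGroup A, g⁻¹ * g' ∈ parab A S₀ → elLength A g₀ ≤ elLength A g' := by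
      obtain ⟨h, hh⟩ := WellFounded.has_min (measure (elLength A)).wf
        {x | g⁻¹ * x ∈ parab A S₀} ⟨g, by simp [one_mem]⟩
      exact ⟨h, hh.1, fun g' hg' => not_lt.1 (hh.2 g' hg')⟩
    refine ⟨g₀, ⟨h₀, hm⟩, fun g₁ ⟨h₁, hm₁⟩ => ?_⟩
    have hx : g₀⁻¹ * g₁ ∈ parab A S₀ := by
      have := mul_mem (inv_mem h₀) h₁
      rwa [mul_inv_rev, inv_inv, mul_assoc, mul_inv_cancel_left] at this
    have hs := size_mul_of_minimal hlarge (hmin g₀ h₀ hm) hx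
    have hle := hm₁ g₀ h₀
    rw [elLength_eq hlarge, elLength_eq hlarge] at hle
    rw [mul_inv_cancel_left] at hs
    exact (inv_mul_eq_one.1 (eq_one_of_size hlarge (g := g₀⁻¹ * g₁) (by omega))).symm

end ArtinTits
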